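/- arXiv:math/0004134 — 2 statements merged into one kernel-verified Lean document; each statement's English description precedes it below -/
import Mathlib

section
/- For every integer q ≥ 1 and any 3q − 1 points p₁,…,p_{3q−1} ∈ ℝP², there exists a nonzero homogeneous polynomial F ∈ ℝ[x₀,x₁,x₂] of degree q such that some connected component of the real point set Z(F) contains all of the points (i.e. c'(q) ≥ c(q) ≥ 3q − 1). -/
noncomputable section

/-- The real projective plane, the projectivization of `ℝ³`. -/
abbrev RP2 := Projectivization ℝ (Fin 3 → ℝ)

/-- `ℝP²` carries the quotient topology from `ℝ³ ∖ {0}`. -/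
instance : TopologicalSpace RP2 :=
  inferInstanceAs (TopologicalSpace (Quotient (projectivizationSetoid ℝ (Fin 3 → ℝ))))

/-- The real point set of the plane curve defined by `F ∈ ℝ[x₀,x₁,x₂]`; for homogeneous `F`
this is well defined (independent of the representative). -/
def zeroSet (F : MvPolynomial (Fin 3) ℝ) : Set RP2 :=
  {p | MvPolynomial.eval p.rep F = 0}

/-- The set `S` lies in a single connected component of `Z ⊆ ℝP²` (with the subspace topology):
some connected component of `Z` contains `S`. -/
def inOneComponent (Z S : Set RP2) : Prop :=
  ∃ p ∈ Z, S ⊆ connectedComponentIn Z p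

open Set Topology

/-- Two points are linked in `A` when some preconnected subset of `A` contains both. -/
def Linked {X : Type*} [TopologicalSpace X] (A : Set X) (x y : X) : Prop :=
  ∃ K ⊆ A, IsPreconnected K ∧ x ∈ K ∧ y ∈ K

namespace Linked

variable {X Y : Type*} [TopologicalSpace X] [TopologicalSpace Y] {A B : Set X} {x y z : X}

lemma refl (hx : x ∈ A) : Linked A x x :=
  ⟨{x}, by simpa using hx, isPreconnected_singleton, rfl, rfl⟩

lemma symm (h : Linked A x y) : Linked A y x := by
  obtain ⟨K, hK, hc, hx, hy⟩ := h
  exact ⟨K, hK, hc, hy, hx⟩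

lemma trans (h : Linked A x y) (h' : Linked A y z) : Linked A x z := by
  obtain ⟨K, hK, hc, hx, hy⟩ := h
  obtain ⟨K', hK', hc', hy', hz⟩ := h'
  exact ⟨K ∪ K', union_subset hK hK', hc.union y hy hy' hc', Or.inl hx, Or.inr hz⟩

lemma mono (h : Linked A x y) (hAB : A ⊆ B) : Linked B x y := by
  obtain ⟨K, hK, hc, hx, hy⟩ := h
  exact ⟨K, hK.trans hAB, hc, hx, hy⟩

lemma left_mem (h : Linked A x y) : x ∈ A := by
  obtain ⟨K, hK, -, hx, -⟩ := h
  exact hK hx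

lemma right_mem (h : Linked A x y) : y ∈ A := h.symm.left_mem

lemma map {f : X → Y} (hf : Continuous f) {C : Set Y} (hAC : MapsTo f A C)
    (h : Linked A x y) : Linked C (f x) (f y) := by
  obtain ⟨K, hK, hc, hx, hy⟩ := h
  exact ⟨f '' K, (hAC.mono_left hK).image_subset, hc.image f hf.continuousOn,
    mem_image_of_mem f hx, mem_image_of_mem f hy⟩

lemma mem_connectedComponentIn (h : Linked A x y) : y ∈ connectedComponentIn A x := by
  obtain ⟨K, hK, hc, hx, hy⟩ := h
  exact hc.subset_connectedComponentIn hx hK hy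

end Linked

section CompactSpace

variable {X : Type*} [TopologicalSpace X] [CompactSpace X] [T2Space X]

/-- In a compact Hausdorff space, unlinked points of a closed set are separated by a partition
of that set into two closed pieces. -/
lemma exists_closed_partition {A : Set X} (hA : IsClosed A) {x y : X} (hx : x ∈ A)
    (hxy : ¬ Linked A x y) :
    ∃ C D : Set X, IsClosed C ∧ IsClosed D ∧ Disjoint C D ∧ C ∪ D = A ∧ x ∈ C ∧ y ∉ C := by
  by_cases hy : y ∈ A
  swap
  · exact ⟨A, ∅, hA, isClosed_empty, disjoint_empty _, union_empty _, hx, hy⟩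
  have : CompactSpace A := isCompact_iff_compactSpace.mp hA.isCompact
  have hne : (⟨y, hy⟩ : A) ∉ connectedComponent (⟨x, hx⟩ : A) := by
    intro h
    refine hxy ⟨Subtype.val '' connectedComponent (⟨x, hx⟩ : A), ?_,
      isPreconnected_connectedComponent.image _ continuous_subtype_val.continuousOn,
      ⟨_, mem_connectedComponent, rfl⟩, ⟨_, h, rfl⟩⟩
    rintro _ ⟨z, -, rfl⟩
    exact z.2
  rw [connectedComponent_eq_iInter_isClopen] at hne
  simp only [mem_iInter, not_forall] at hne
  obtain ⟨⟨s, hs, hxs⟩, hys⟩ := hne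
  refine ⟨Subtype.val '' s, Subtype.val '' sᶜ, hA.isClosedMap_subtype_val _ hs.isClosed,
    hA.isClosedMap_subtype_val _ hs.compl.isClosed, ?_, ?_, ⟨_, hxs, rfl⟩, ?_⟩
  · exact (disjoint_image_iff Subtype.val_injective).mpr disjoint_compl_right
  · rw [← image_union, union_compl_self, image_univ, Subtype.range_coe]
  · rintro ⟨z, hz, rfl⟩
    exact hys hz

lemma exists_closed_partition_finset {A : Set X} (hA : IsClosed A) {x : X} (hx : x ∈ A)
    (T : Finset X) (hT : ∀ y ∈ T, ¬ Linked A x y) :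
    ∃ C D : Set X, IsClosed C ∧ IsClosed D ∧ Disjoint C D ∧ C ∪ D = A ∧ x ∈ C ∧
      ∀ y ∈ T, y ∉ C := by
  classical
  induction T using Finset.induction_on with
  | empty => exact ⟨A, ∅, hA, isClosed_empty, disjoint_empty _, union_empty _, hx, by simp⟩
  | insert y T _ ih =>
    obtain ⟨C, D, hC, hD, hCD, hu, hxC, hTC⟩ := ih fun z hz ↦ hT z (Finset.mem_insert_of_mem hz)
    obtain ⟨C', D', hC', hD', hCD', hu', hxC', hyC'⟩ :=
      exists_closed_partition hA hx (hT y (Finset.mem_insert_self _ _))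
    refine ⟨C ∩ C', D ∪ D', hC.inter hC', hD.union hD', ?_, ?_, ⟨hxC, hxC'⟩, ?_⟩
    · rw [disjoint_union_right]
      exact ⟨hCD.mono_left inter_subset_left, hCD'.mono_left inter_subset_right⟩
    · ext z
      have h1 := Set.ext_iff.mp hu z
      have h2 := Set.ext_iff.mp hu' z
      simp only [mem_union, mem_inter_iff] at *
      tauto
    · intro z hz hzC
      rcases Finset.mem_insert.mp hz with rfl | hz
      · exact hyC' hzC.2
      · exact hTC z hz hzC.1

/-- Being linked in the fibres of a closed family of subsets of a compact space is a closed
condition. -/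
lemma isClosed_setOf_linked {P : Type*} [TopologicalSpace P] {C : Set (P × X)}
    (hC : IsClosed C) :
    IsClosed {r : P × X × X | Linked {z | (r.1, z) ∈ C} r.2.1 r.2.2} := by
  rw [← isOpen_compl_iff, isOpen_iff_mem_nhds]
  rintro ⟨p, x, y⟩ h
  have h : ¬ Linked {z | (p, z) ∈ C} x y := h
  by_cases hx : (p, x) ∈ C
  swap
  · have : IsOpen {r : P × X × X | (r.1, r.2.1) ∉ C} :=
      hC.isOpen_compl.preimage (by fun_prop)
    filter_upwards [this.mem_nhds hx] with r hr hl
    exact hr hl.left_mem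
  by_cases hy : (p, y) ∈ C
  swap
  · have : IsOpen {r : P × X × X | (r.1, r.2.2) ∉ C} :=
      hC.isOpen_compl.preimage (by fun_prop)
    filter_upwards [this.mem_nhds hy] with r hr hl
    exact hr hl.right_mem
  have hA : IsClosed {z | (p, z) ∈ C} := hC.preimage (by fun_prop)
  obtain ⟨D, E, hD, hE, hDE, hu, hxD, hyD⟩ := exists_closed_partition hA hx h
  have hyE : y ∈ E := by
    have : y ∈ D ∪ E := hu ▸ hy
    exact this.resolve_left hyD
  obtain ⟨U, V, hU, hV, hDU, hEV, hUV⟩ := normal_separation hD hE hDE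
  have hW : IsOpen {r : P | ∀ z, (r, z) ∈ C → z ∈ U ∪ V} := by
    have := isClosedMap_fst_of_compactSpace (X := P) (Y := X) _
      (hC.inter ((hU.union hV).isClosed_compl.preimage continuous_snd))
    rw [← isOpen_compl_iff] at this
    convert this using 1
    ext r
    simp only [mem_ofPred_eq, mem_compl_iff, mem_image, mem_inter_iff, mem_preimage, Prod.exists,
      not_exists, not_and]
    constructor
    · rintro h a b ⟨hab, hb⟩ rfl
      exact hb (h b hab)
    · intro h z hz
      by_contra hz'
      exact h r z ⟨hz, hz'⟩ rfl
  have hp : p ∈ {r : P | ∀ z, (r, z) ∈ C → z ∈ U ∪ V} := by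
    intro z hz
    have : z ∈ D ∪ E := hu ▸ hz
    exact this.imp (fun h ↦ hDU h) (fun h ↦ hEV h)
  filter_upwards [(hW.prod (hU.prod hV)).mem_nhds (show (p, x, y) ∈ _ from
    ⟨hp, hDU hxD, hEV hyE⟩)]
  rintro ⟨p', x', y'⟩ ⟨hp', hx', hy'⟩ ⟨K, hK, hc, hxK, hyK⟩
  obtain ⟨z, -, hz⟩ := hc U V hU hV (fun z hz ↦ hp' z (hK hz)) ⟨x', hxK, hx'⟩ ⟨y', hyK, hy'⟩
  exact hUV.le_bot hz

end CompactSpace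

/-- A space on which every circle-valued map has a real-valued logarithm. -/
def LiftsCircle (X : Type*) [TopologicalSpace X] : Prop :=
  ∀ f : C(X, Circle), ∃ φ : C(X, ℝ), ∀ x, f x = Circle.exp (φ x)

lemma IsPreconnected.eq_of_forall_int {X : Type*} [TopologicalSpace X] {K : Set X}
    (hK : IsPreconnected K) {f : X → ℝ} (hf : ContinuousOn f K)
    (h : ∀ x ∈ K, ∃ n : ℤ, f x = n) {x y : X} (hx : x ∈ K) (hy : y ∈ K) : f x = f y := by
  have key : ∀ x ∈ K, ∀ y ∈ K, ¬ f x < f y := by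
    intro x hx y hy hlt
    obtain ⟨m, hm⟩ := h x hx
    obtain ⟨n, hn⟩ := h y hy
    have hmn : m + 1 ≤ n := by
      rw [hm, hn] at hlt
      exact_mod_cast hlt
    have hmn' : (m : ℝ) + 1 ≤ n := by exact_mod_cast hmn
    obtain ⟨z, hz, hfz⟩ := hK.intermediate_value hx hy hf
      (show (m : ℝ) + 1 / 2 ∈ Icc (f x) (f y) by rw [hm, hn]; constructor <;> linarith)
    obtain ⟨k, hk⟩ := h z hz
    rw [hk] at hfz
    have h1 : (m : ℝ) < k := by linarith
    have h2 : (k : ℝ) < m + 1 := by linarith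
    have h1' : m < k := by exact_mod_cast h1
    have h2' : k < m + 1 := by exact_mod_cast h2
    omega
  exact le_antisymm (not_lt.mp (key y hy x hx)) (not_lt.mp (key x hx y hy))

lemma Circle.exists_int_of_exp_two_pi_mul_eq_one {t : ℝ} (h : Circle.exp (2 * Real.pi * t) = 1) :
    ∃ n : ℤ, t = n := by
  obtain ⟨n, hn⟩ := Circle.exp_eq_one.mp h
  refine ⟨n, ?_⟩
  have := Real.pi_pos
  field_simp at hn
  linarith

/-- A Mayer–Vietoris principle: over a space whose circle-valued maps lift, the characteristic
function of a piece of `A ∩ B` is a sum of locally constant functions on `A` and on `B`. -/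
lemma LiftsCircle.exists_potentials {X : Type*} [TopologicalSpace X] [CompactSpace X] [T2Space X]
    (hX : LiftsCircle X) {A B : Set X} (hA : IsClosed A) (hB : IsClosed B) (hAB : A ∪ B = univ)
    {x : X} (hx : x ∈ A ∩ B) (T : Finset X) (hTm : ∀ y ∈ T, y ∈ A ∩ B)
    (hT : ∀ y ∈ T, ¬ Linked (A ∩ B) x y) :
    ∃ a b : X → ℝ, (∀ u v, Linked A u v → a u = a v) ∧ (∀ u v, Linked B u v → b u = b v) ∧
      a x + b x = 1 ∧ ∀ y ∈ T, a y + b y = 0 := by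
  classical
  obtain ⟨C, D, hC, hD, hCD, hu, hxC, hTC⟩ :=
    exists_closed_partition_finset (hA.inter hB) hx T hT
  obtain ⟨c, hc0, hc1, -⟩ := exists_continuous_zero_one_of_isClosed hD hC hCD.symm
  have hc : ∀ z ∈ A ∩ B, Circle.exp (2 * Real.pi * c z) = 1 := by
    intro z hz
    rw [← hu] at hz
    rcases hz with hz | hz
    · rw [hc1 hz]; simp
    · rw [hc0 hz]; simp
  let f : X → Circle := fun z ↦ if z ∈ A then Circle.exp (2 * Real.pi * c z) else 1
  have hfA : ∀ z ∈ A, f z = Circle.exp (2 * Real.pi * c z) := fun z hz ↦ if_pos hz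
  have hfB : ∀ z ∈ B, f z = 1 := by
    intro z hz
    by_cases hzA : z ∈ A
    · rw [hfA z hzA, hc z ⟨hzA, hz⟩]
    · exact if_neg hzA
  have hf : Continuous f := by
    rw [← continuousOn_univ, ← hAB]
    refine ContinuousOn.union_of_isClosed ?_ ?_ hA hB
    · exact (Continuous.continuousOn (by fun_prop)).congr hfA
    · exact continuousOn_const.congr hfB
  obtain ⟨φ, hφ⟩ := hX ⟨f, hf⟩
  have hφ : ∀ z, f z = Circle.exp (2 * Real.pi * (φ z / (2 * Real.pi))) := by
    intro z
    have := Real.pi_pos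
    rw [mul_div_cancel₀ _ (by positivity)]
    exact hφ z
  refine ⟨fun z ↦ c z - φ z / (2 * Real.pi), fun z ↦ φ z / (2 * Real.pi), ?_, ?_, ?_, ?_⟩
  · rintro u v ⟨K, hK, hc', hu, hv⟩
    refine hc'.eq_of_forall_int (f := fun z ↦ c z - φ z / (2 * Real.pi)) (by fun_prop) ?_ hu hv
    intro z hz
    apply Circle.exists_int_of_exp_two_pi_mul_eq_one
    rw [mul_sub, Circle.exp_sub, ← hφ, hfA z (hK hz), div_self']
  · rintro u v ⟨K, hK, hc', hu, hv⟩
    refine hc'.eq_of_forall_int (f := fun z ↦ φ z / (2 * Real.pi)) (by fun_prop) ?_ hu hv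
    intro z hz
    apply Circle.exists_int_of_exp_two_pi_mul_eq_one
    rw [← hφ, hfB z (hK hz)]
  · simp [hc1 hxC]
  · intro y hy
    have : y ∈ D := by
      have : y ∈ C ∪ D := hu ▸ hTm y hy
      exact this.resolve_left (hTC y hy)
    simp [hc0 this]

/-- The unit sphere in `ℝ³`. -/
abbrev S2 := Metric.sphere (0 : EuclideanSpace ℝ (Fin 3)) 1

namespace S2

lemma exists_log_off_point (f : C(S2, Circle)) (v : S2) :
    ∃ φ : S2 → ℝ, ContinuousOn φ {v}ᶜ ∧ ∀ x, x ≠ v → f x = Circle.exp (φ x) := by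
  have hv : ‖(v : EuclideanSpace ℝ (Fin 3))‖ = 1 := norm_eq_of_mem_sphere v
  let σ := stereographic hv
  have hσ : Continuous σ.symm := by
    rw [← continuousOn_univ, ← stereographic_target hv]
    exact σ.continuousOn_symm
  obtain ⟨e, he⟩ : ∃ e : ℝ, Circle.exp e = f (σ.symm 0) :=
    ⟨_, Circle.exp_arg _⟩
  obtain ⟨Φ, ⟨-, hΦ⟩, -⟩ := Circle.isCoveringMap_exp.existsUnique_continuousMap_lifts
    (f.comp ⟨σ.symm, hσ⟩) 0 e he
  have hs : σ.source = {v}ᶜ := stereographic_source hv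
  refine ⟨Φ ∘ σ, ?_, ?_⟩
  · rw [← hs]
    exact Φ.continuous.comp_continuousOn σ.continuousOn
  · intro x hx
    have hx' : x ∈ σ.source := by rw [hs]; exact hx
    have := congrFun hΦ (σ x)
    simp only [Function.comp_apply, ContinuousMap.comp_apply, ContinuousMap.coe_mk] at this
    rw [σ.left_inv hx'] at this
    exact this.symm

lemma isPreconnected_compl_pair (v : S2) : IsPreconnected ({v, -v}ᶜ : Set S2) := by
  have hv : ‖(v : EuclideanSpace ℝ (Fin 3))‖ = 1 := norm_eq_of_mem_sphere v
  let σ := stereographic hv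
  have hσ : Continuous σ.symm := by
    rw [← continuousOn_univ, ← stereographic_target hv]
    exact σ.continuousOn_symm
  have hs : σ.source = {v}ᶜ := stereographic_source hv
  have ht : σ.target = univ := stereographic_target hv
  have : Fact (Module.finrank ℝ (EuclideanSpace ℝ (Fin 3)) = 2 + 1) := ⟨by simp⟩
  have hfr : Module.finrank ℝ (ℝ ∙ (v : EuclideanSpace ℝ (Fin 3)))ᗮ = 2 :=
    Submodule.finrank_orthogonal_span_singleton (by rintro h; simp [h] at hv)
  have hrank : 1 < Module.rank ℝ (ℝ ∙ (v : EuclideanSpace ℝ (Fin 3)))ᗮ := by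
    rw [← Module.finrank_eq_rank, hfr]
    norm_num
  have h := (isConnected_compl_singleton_of_one_lt_rank hrank (σ (-v))).isPreconnected.image
    σ.symm hσ.continuousOn
  have hne : -v ∈ σ.source := by
    rw [hs]
    exact fun h ↦ ne_neg_of_mem_unit_sphere ℝ v (mem_singleton_iff.mp h).symm
  convert h using 1
  ext x
  simp only [mem_compl_iff, mem_insert_iff, mem_singleton_iff, not_or, mem_image]
  constructor
  · rintro ⟨h1, h2⟩
    have hx : x ∈ σ.source := by rw [hs]; exact h1
    exact ⟨σ x, fun h ↦ h2 (σ.injOn hx hne h), σ.left_inv hx⟩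
  · rintro ⟨w, hw, rfl⟩
    have hw' : w ∈ σ.target := by rw [ht]; trivial
    refine ⟨?_, ?_⟩
    · have := σ.map_target hw'
      rw [hs] at this
      exact this
    · intro h
      apply hw
      rw [← h, σ.right_inv hw']

lemma liftsCircle : LiftsCircle S2 := by
  classical
  intro f
  let v : S2 := ⟨EuclideanSpace.single 0 1, by simp⟩
  have hvne : v ≠ -v := ne_neg_of_mem_unit_sphere ℝ v
  obtain ⟨φ, hφ, hfφ⟩ := exists_log_off_point f v
  obtain ⟨ψ, hψ, hfψ⟩ := exists_log_off_point f (-v)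
  have hc : ContinuousOn (fun x ↦ (φ x - ψ x) / (2 * Real.pi)) ({v, -v}ᶜ : Set S2) := by
    refine ContinuousOn.div_const (ContinuousOn.sub (hφ.mono ?_) (hψ.mono ?_)) _ <;>
    · intro x hx
      simp only [mem_compl_iff, mem_insert_iff, mem_singleton_iff, not_or] at hx ⊢
      tauto
  have hpi := Real.pi_pos
  obtain ⟨k, hk1, hk⟩ : ∃ k : ℝ, Circle.exp k = 1 ∧ ∀ x, x ≠ v → x ≠ -v → φ x = ψ x + k := by
    by_cases hne : ∃ x : S2, x ≠ v ∧ x ≠ -v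
    swap
    · push Not at hne
      exact ⟨0, Circle.exp_zero, fun x h1 h2 ↦ absurd (hne x h1) h2⟩
    obtain ⟨x₀, h1, h2⟩ := hne
    refine ⟨φ x₀ - ψ x₀, by rw [Circle.exp_sub, ← hfφ x₀ h1, ← hfψ x₀ h2, div_self'],
      fun x hx1 hx2 ↦ ?_⟩
    have := (isPreconnected_compl_pair v).eq_of_forall_int hc ?_
      (x := x) (y := x₀) (by simp [hx1, hx2]) (by simp [h1, h2])
    · field_simp at this
      linarith
    · intro y hy
      simp only [mem_compl_iff, mem_insert_iff, mem_singleton_iff, not_or] at hy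
      apply Circle.exists_int_of_exp_two_pi_mul_eq_one
      rw [mul_div_cancel₀ _ (by positivity), Circle.exp_sub, ← hfφ y hy.1, ← hfψ y hy.2, div_self']
  let θ : S2 → ℝ := fun x ↦ if x = v then ψ x + k else φ x
  have hθφ : ∀ x, x ≠ v → θ x = φ x := fun x hx ↦ if_neg hx
  have hθψ : ∀ x, x ≠ -v → θ x = ψ x + k := by
    intro x hx
    by_cases h : x = v
    · exact if_pos h
    · rw [hθφ x h, hk x h hx]
  have hθ : Continuous θ := by
    rw [continuous_iff_continuousAt]
    intro x
    by_cases hx : x = v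
    · have hx' : x ≠ -v := hx ▸ hvne
      have hU : ({-v}ᶜ : Set S2) ∈ 𝓝 x := isOpen_compl_singleton.mem_nhds hx'
      refine ((hψ.continuousAt hU).add (continuousAt_const (y := k))).congr ?_
      filter_upwards [hU] with y hy using (hθψ y hy).symm
    · have hU : ({v}ᶜ : Set S2) ∈ 𝓝 x := isOpen_compl_singleton.mem_nhds hx
      refine (hφ.continuousAt hU).congr ?_
      filter_upwards [hU] with y hy using (hθφ y hy).symm
  refine ⟨⟨θ, hθ⟩, fun x ↦ ?_⟩
  change f x = Circle.exp (θ x)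
  by_cases hx : x = v
  · have hx' : x ≠ -v := hx ▸ hvne
    rw [hθψ x hx', Circle.exp_add, hk1, mul_one, hfψ x hx']
  · rw [hθφ x hx, hfφ x hx]

end S2

namespace S2

/-- The coordinate vector of a point of the sphere. -/
def vec (x : S2) : Fin 3 → ℝ := WithLp.ofLp (x : EuclideanSpace ℝ (Fin 3))

lemma continuous_vec : Continuous vec :=
  (PiLp.continuous_ofLp 2 _).comp continuous_subtype_val

@[simp] lemma vec_neg (x : S2) : vec (-x) = -vec x := by
  simp [vec]

lemma vec_injective : Function.Injective vec :=
  (WithLp.ofLp_injective 2).comp Subtype.val_injective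

lemma sum_vec_sq (x : S2) : ∑ i, vec x i ^ 2 = 1 := by
  have h : ‖(x : EuclideanSpace ℝ (Fin 3))‖ = 1 := norm_eq_of_mem_sphere x
  have h' := EuclideanSpace.real_norm_sq_eq (x : EuclideanSpace ℝ (Fin 3))
  rw [h] at h'
  simpa [vec] using h'.symm

lemma vec_ne_zero (x : S2) : vec x ≠ 0 := by
  intro h
  simpa [h] using sum_vec_sq x

/-- Radial projection to the sphere. -/
lemma exists_radial_projection : ∃ ρ : {u : Fin 3 → ℝ // u ≠ 0} → S2, Continuous ρ ∧
    (∀ u, ∃ c : ℝ, 0 < c ∧ vec (ρ u) = c • u.1) ∧ ∀ x : S2, ρ ⟨vec x, vec_ne_zero x⟩ = x := by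
  have hne : ∀ u : {u : Fin 3 → ℝ // u ≠ 0}, WithLp.toLp 2 u.1 ≠ 0 := fun u h ↦
    u.2 (by simpa using h)
  refine ⟨fun u ↦ ⟨‖WithLp.toLp 2 u.1‖⁻¹ • WithLp.toLp 2 u.1, ?_⟩, ?_, ?_, ?_⟩
  · rw [mem_sphere_zero_iff_norm, norm_smul, norm_inv, norm_norm,
      inv_mul_cancel₀ (norm_ne_zero_iff.mpr (hne u))]
  · have hc : Continuous fun u : {u : Fin 3 → ℝ // u ≠ 0} ↦ WithLp.toLp 2 u.1 :=
      (PiLp.continuous_toLp 2 _).comp continuous_subtype_val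
    exact Continuous.subtype_mk
      ((hc.norm.inv₀ fun u ↦ norm_ne_zero_iff.mpr (hne u)).smul hc) _
  · intro u
    exact ⟨‖WithLp.toLp 2 u.1‖⁻¹, inv_pos.mpr (norm_pos_iff.mpr (hne u)), by simp [vec]⟩
  · intro x
    apply Subtype.ext
    have h : ‖(x : EuclideanSpace ℝ (Fin 3))‖ = 1 := norm_eq_of_mem_sphere x
    simp [vec, h]

lemma exists_vec_eq_smul {u : Fin 3 → ℝ} (hu : u ≠ 0) :
    ∃ x : S2, ∃ c : ℝ, 0 < c ∧ vec x = c • u := by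
  obtain ⟨ρ, -, h, -⟩ := exists_radial_projection
  exact ⟨ρ ⟨u, hu⟩, h ⟨u, hu⟩⟩

lemma eq_of_smul_vec_eq {x y : S2} {s t : ℝ} (hs : 0 ≤ s) (ht : 0 ≤ t) (hst : s ≠ 0 ∨ t ≠ 0)
    (h : s • vec x = t • vec y) : x = y := by
  have hx := sum_vec_sq x
  have hy := sum_vec_sq y
  have h2 : s ^ 2 = t ^ 2 := by
    have : ∑ i, (s * vec x i) ^ 2 = ∑ i, (t * vec y i) ^ 2 :=
      Finset.sum_congr rfl fun i _ ↦ by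
        have := congrFun h i
        simp only [Pi.smul_apply, smul_eq_mul] at this
        rw [this]
    simpa [mul_pow, ← Finset.mul_sum, hx, hy] using this
  have hst' : s = t := (pow_left_inj₀ hs ht two_ne_zero).mp h2
  subst hst'
  exact vec_injective (smul_right_injective _ (by tauto : s ≠ 0) h)

/-- Independence of the coordinate vectors of two points that are neither equal nor antipodal. -/
lemma eq_zero_of_smul_add_smul {x y : S2} (h1 : y ≠ x) (h2 : y ≠ -x) {s t : ℝ}
    (h : s • vec x + t • vec y = 0) : s = 0 ∧ t = 0 := by
  by_contra hst
  have hst : s ≠ 0 ∨ t ≠ 0 := by tauto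
  have e1 : |s| • vec x = |t| • vec y ∨ |s| • vec x = |t| • vec (-y) := by
    have h' : s • vec x = -(t • vec y) := eq_neg_of_add_eq_zero_left h
    rcases abs_cases s with ⟨a, -⟩ | ⟨a, -⟩ <;> rcases abs_cases t with ⟨b, -⟩ | ⟨b, -⟩ <;>
      rw [a, b] <;> simp [h']
  have hst' : |s| ≠ 0 ∨ |t| ≠ 0 := by simpa using hst
  rcases e1 with e | e
  · exact h1 (eq_of_smul_vec_eq (abs_nonneg _) (abs_nonneg _) hst' e).symm
  · exact h2 (by rw [eq_of_smul_vec_eq (abs_nonneg _) (abs_nonneg _) hst' e, neg_neg])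

/-- The great circle arc from `x` to `y` links the two points. -/
lemma linked_of_cone {x y : S2} (hxy : y ≠ -x) {A : Set S2}
    (hA : ∀ s t : ℝ, 0 ≤ s → 0 ≤ t → ∀ z, vec z = s • vec x + t • vec y → z ∈ A) :
    Linked A x y := by
  obtain ⟨ρ, hρ, hρs, hρx⟩ := exists_radial_projection
  have hne : ∀ t : Icc (0 : ℝ) 1, (1 - t.1) • vec x + t.1 • vec y ≠ 0 := by
    rintro ⟨t, ht0, ht1⟩ h
    refine hxy ?_
    have : (1 - t) • vec x = t • vec (-y) := by
      rw [vec_neg, smul_neg]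
      exact eq_neg_of_add_eq_zero_left h
    rw [eq_of_smul_vec_eq (by linarith) ht0 ?_ this, neg_neg]
    by_contra hcon
    push Not at hcon
    linarith [hcon.1, hcon.2]
  let γ : Icc (0 : ℝ) 1 → S2 := fun t ↦ ρ ⟨(1 - t.1) • vec x + t.1 • vec y, hne t⟩
  have hγ : Continuous γ := hρ.comp (by fun_prop)
  have key : Linked A (γ 0) (γ 1) := by
    refine Linked.map (A := univ) hγ ?_ ⟨univ, subset_rfl, isPreconnected_univ, trivial, trivial⟩
    rintro ⟨t, ht0, ht1⟩ -
    obtain ⟨c, hc, hv⟩ := hρs ⟨_, hne ⟨t, ht0, ht1⟩⟩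
    refine hA (c * (1 - t)) (c * t) (mul_nonneg hc.le (by linarith)) (by positivity) _ ?_
    rw [hv, smul_add, smul_smul, smul_smul]
  have h0 : γ 0 = x := by
    rw [← hρx x]
    exact congrArg ρ (Subtype.ext (by simp))
  have h1 : γ 1 = y := by
    rw [← hρx y]
    exact congrArg ρ (Subtype.ext (by simp))
  rwa [h0, h1] at key

end S2

lemma MvPolynomial.IsHomogeneous.eval_smul {σ : Type*} {q : ℕ} {F : MvPolynomial σ ℝ}
    (hF : F.IsHomogeneous q) (c : ℝ) (x : σ → ℝ) :
    MvPolynomial.eval (c • x) F = c ^ q * MvPolynomial.eval x F := by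
  rw [MvPolynomial.eval_eq, MvPolynomial.eval_eq, Finset.mul_sum]
  refine Finset.sum_congr rfl fun d hd ↦ ?_
  rw [hF.degree_eq_sum_deg_support hd]
  simp only [Pi.smul_apply, smul_eq_mul, mul_pow, Finset.prod_mul_distrib,
    Finset.prod_pow_eq_pow_sum]
  ring

/-- A homogeneous polynomial restricted to a plane is a binary form. -/
lemma MvPolynomial.IsHomogeneous.exists_binary_form {q : ℕ} {F : MvPolynomial (Fin 3) ℝ}
    (hF : F.IsHomogeneous q) (x y : Fin 3 → ℝ) :
    ∃ c : ℕ → ℝ, ∀ s t : ℝ, MvPolynomial.eval (s • x + t • y) F =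
      ∑ k ∈ Finset.range (q + 1), c k * s ^ (q - k) * t ^ k := by
  let P : Polynomial ℝ :=
    MvPolynomial.aeval (fun i ↦ Polynomial.C (x i) + Polynomial.C (y i) * Polynomial.X) F
  have hP : P.natDegree < q + 1 := by
    refine Nat.lt_succ_of_le ?_
    simpa using MvPolynomial.aeval_natDegree_le F hF.totalDegree_le
      (fun i ↦ Polynomial.C (x i) + Polynomial.C (y i) * Polynomial.X) (n := 1)
      (fun i ↦ by compute_degree)
  have hev : ∀ t : ℝ, P.eval t = MvPolynomial.eval (x + t • y) F := by
    intro t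
    have h : (Polynomial.aeval t).comp (MvPolynomial.aeval fun i ↦
        Polynomial.C (x i) + Polynomial.C (y i) * Polynomial.X) =
        MvPolynomial.aeval (x + t • y) := by
      refine MvPolynomial.algHom_ext fun i ↦ ?_
      simp only [AlgHom.comp_apply, MvPolynomial.aeval_X, map_add, map_mul, Polynomial.aeval_C,
        Polynomial.aeval_X, Pi.add_apply, Pi.smul_apply, smul_eq_mul, Algebra.algebraMap_self_apply]
      ring
    simpa [MvPolynomial.aeval_eq_eval, Polynomial.coe_aeval_eq_eval] using DFunLike.congr_fun h F
  refine ⟨P.coeff, fun s t ↦ ?_⟩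
  refine congrFun (Continuous.ext_on (dense_compl_singleton (0 : ℝ))
    (f := fun s ↦ MvPolynomial.eval (s • x + t • y) F)
    (g := fun s ↦ ∑ k ∈ Finset.range (q + 1), P.coeff k * s ^ (q - k) * t ^ k)
    ?_ (by fun_prop) ?_) s
  · exact (MvPolynomial.continuous_eval F).comp (by fun_prop)
  · intro s hs
    have hs : s ≠ 0 := hs
    have e : s • x + t • y = s • (x + (t / s) • y) := by
      rw [smul_add, smul_smul, mul_div_cancel₀ _ hs]
    simp only
    rw [e, hF.eval_smul, ← hev, Polynomial.eval_eq_sum_range' hP, Finset.mul_sum]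
    refine Finset.sum_congr rfl fun k hk ↦ ?_
    have hk : k ≤ q := Nat.lt_succ_iff.mp (Finset.mem_range.mp hk)
    rw [div_pow, ← Nat.sub_add_cancel hk, pow_add, Nat.add_sub_cancel]
    field_simp

namespace S2

variable {F : MvPolynomial (Fin 3) ℝ} {x y z w : S2}

/-- The points of the sphere at which `F` is nonnegative. -/
def nonneg (F : MvPolynomial (Fin 3) ℝ) : Set S2 := {x | 0 ≤ MvPolynomial.eval (vec x) F}

/-- The zeros of `F` on the sphere. -/
def zeros (F : MvPolynomial (Fin 3) ℝ) : Set S2 := {x | MvPolynomial.eval (vec x) F = 0}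

/-- `x` is linked in `A` to `y` or to its antipode. -/
def Rel (A : Set S2) (x y : S2) : Prop := Linked A x y ∨ Linked A x (-y)

lemma nonneg_inter_nonneg_neg (F : MvPolynomial (Fin 3) ℝ) :
    nonneg F ∩ nonneg (-F) = zeros F := by
  ext x
  simp only [nonneg, zeros, mem_inter_iff, mem_ofPred_eq, map_neg]
  constructor
  · rintro ⟨h1, h2⟩
    linarith
  · intro h
    simp [h]

lemma nonneg_union_nonneg_neg (F : MvPolynomial (Fin 3) ℝ) :
    nonneg F ∪ nonneg (-F) = univ := by
  ext x
  simp only [nonneg, mem_union, mem_ofPred_eq, map_neg, mem_univ, iff_true]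
  rcases le_total 0 (MvPolynomial.eval (vec x) F) with h | h
  · exact Or.inl h
  · exact Or.inr (by linarith)

@[simp] lemma zeros_neg (F : MvPolynomial (Fin 3) ℝ) : zeros (-F) = zeros F := by
  simp [zeros]

lemma isClosed_nonneg (F : MvPolynomial (Fin 3) ℝ) : IsClosed (nonneg F) :=
  isClosed_le continuous_const ((MvPolynomial.continuous_eval F).comp continuous_vec)

lemma _root_.Linked.nonneg_of_zeros (h : Linked (zeros F) x y) : Linked (nonneg F) x y :=
  h.mono (by rw [← nonneg_inter_nonneg_neg]; exact inter_subset_left)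

lemma _root_.Linked.nonneg_neg_of_zeros (h : Linked (zeros F) x y) : Linked (nonneg (-F)) x y :=
  h.mono (by rw [← nonneg_inter_nonneg_neg]; exact inter_subset_right)

lemma exists_potentials (hx : x ∈ zeros F) (T : Finset S2) (hTm : ∀ y ∈ T, y ∈ zeros F)
    (hT : ∀ y ∈ T, ¬ Linked (zeros F) x y) :
    ∃ a b : S2 → ℝ, (∀ u v, Linked (nonneg F) u v → a u = a v) ∧
      (∀ u v, Linked (nonneg (-F)) u v → b u = b v) ∧
      a x + b x = 1 ∧ ∀ y ∈ T, a y + b y = 0 := by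
  rw [← nonneg_inter_nonneg_neg] at hx hTm hT
  exact liftsCircle.exists_potentials (isClosed_nonneg F) (isClosed_nonneg (-F))
    (nonneg_union_nonneg_neg F) hx T hTm hT

lemma mem_zeros_of_linked {u v : S2} (h : Linked (nonneg F) x u) (h' : Linked (nonneg (-F)) x v) :
    x ∈ zeros F := by
  rw [← nonneg_inter_nonneg_neg]
  exact ⟨h.left_mem, h'.left_mem⟩

/-- Points linked both in the nonnegative and in the nonpositive region are linked in the
zero set. -/
lemma linked_zeros_of_two_cycle (h1 : Linked (nonneg F) x y) (h2 : Linked (nonneg (-F)) x y) :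
    Linked (zeros F) x y := by
  classical
  by_contra h
  obtain ⟨a, b, ha, hb, hx, hT⟩ := exists_potentials (mem_zeros_of_linked h1 h2) {y}
    (by simpa using mem_zeros_of_linked h1.symm h2.symm) (by simpa using h)
  have := hT y (by simp)
  linarith [ha _ _ h1, hb _ _ h2]

lemma linked_zeros_of_four_cycle (h1 : Linked (nonneg F) x y) (h2 : Linked (nonneg (-F)) y z)
    (h3 : Linked (nonneg F) z w) (h4 : Linked (nonneg (-F)) w x) :
    Linked (zeros F) x y ∨ Linked (zeros F) x z ∨ Linked (zeros F) x w := by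
  classical
  by_contra! h
  have m1 := mem_zeros_of_linked h1.symm h2
  have m2 := mem_zeros_of_linked h3 h2.symm
  have m3 := mem_zeros_of_linked h3.symm h4
  obtain ⟨a, b, ha, hb, hx, hT⟩ := exists_potentials (mem_zeros_of_linked h1 h4.symm) {y, z, w}
    (by simp [m1, m2, m3]) (by simp [h])
  linarith [ha _ _ h1, hb _ _ h2, ha _ _ h3, hb _ _ h4, hT y (by simp), hT z (by simp),
    hT w (by simp)]

lemma linked_zeros_of_six_cycle {u v : S2} (h1 : Linked (nonneg F) x y)
    (h2 : Linked (nonneg (-F)) y z) (h3 : Linked (nonneg F) z u) (h4 : Linked (nonneg (-F)) u v)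
    (h5 : Linked (nonneg F) v w) (h6 : Linked (nonneg (-F)) w x) :
    Linked (zeros F) x y ∨ Linked (zeros F) x z ∨ Linked (zeros F) x u ∨
      Linked (zeros F) x v ∨ Linked (zeros F) x w := by
  classical
  by_contra! h
  have m1 := mem_zeros_of_linked h1.symm h2
  have m2 := mem_zeros_of_linked h3 h2.symm
  have m3 := mem_zeros_of_linked h3.symm h4
  have m4 := mem_zeros_of_linked h5 h4.symm
  have m5 := mem_zeros_of_linked h5.symm h6
  obtain ⟨a, b, ha, hb, hx, hT⟩ := exists_potentials (mem_zeros_of_linked h1 h6.symm)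
    {y, z, u, v, w} (by simp [m1, m2, m3, m4, m5]) (by simp [h])
  linarith [ha _ _ h1, hb _ _ h2, ha _ _ h3, hb _ _ h4, ha _ _ h5, hb _ _ h6, hT y (by simp),
    hT z (by simp), hT u (by simp), hT v (by simp), hT w (by simp)]

lemma linked_zeros_of_eight_cycle {x₀ x₁ x₂ x₃ x₄ x₅ x₆ x₇ : S2}
    (h0 : Linked (nonneg F) x₀ x₁) (h1 : Linked (nonneg (-F)) x₁ x₂)
    (h2 : Linked (nonneg F) x₂ x₃) (h3 : Linked (nonneg (-F)) x₃ x₄)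
    (h4 : Linked (nonneg F) x₄ x₅) (h5 : Linked (nonneg (-F)) x₅ x₆)
    (h6 : Linked (nonneg F) x₆ x₇) (h7 : Linked (nonneg (-F)) x₇ x₀) :
    Linked (zeros F) x₀ x₁ ∨ Linked (zeros F) x₀ x₂ ∨ Linked (zeros F) x₀ x₃ ∨
      Linked (zeros F) x₀ x₄ ∨ Linked (zeros F) x₀ x₅ ∨ Linked (zeros F) x₀ x₆ ∨
      Linked (zeros F) x₀ x₇ := by
  classical
  by_contra! h
  have m1 := mem_zeros_of_linked h0.symm h1
  have m2 := mem_zeros_of_linked h2 h1.symm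
  have m3 := mem_zeros_of_linked h2.symm h3
  have m4 := mem_zeros_of_linked h4 h3.symm
  have m5 := mem_zeros_of_linked h4.symm h5
  have m6 := mem_zeros_of_linked h6 h5.symm
  have m7 := mem_zeros_of_linked h6.symm h7
  obtain ⟨a, b, ha, hb, hx, hT⟩ := exists_potentials (mem_zeros_of_linked h0 h7.symm)
    {x₁, x₂, x₃, x₄, x₅, x₆, x₇} (by simp [m1, m2, m3, m4, m5, m6, m7]) (by simp [h])
  linarith [ha _ _ h0, hb _ _ h1, ha _ _ h2, hb _ _ h3, ha _ _ h4, hb _ _ h5, ha _ _ h6,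
    hb _ _ h7, hT x₁ (by simp), hT x₂ (by simp), hT x₃ (by simp), hT x₄ (by simp),
    hT x₅ (by simp), hT x₆ (by simp), hT x₇ (by simp)]

lemma _root_.Linked.antipodes {A B : Set S2} (hAB : ∀ z ∈ A, -z ∈ B) (h : Linked A x y) :
    Linked B (-x) (-y) :=
  h.map continuous_neg hAB

namespace Rel

variable {A : Set S2}

lemma refl (hx : x ∈ A) : Rel A x x := Or.inl (Linked.refl hx)

lemma symm (hA : ∀ z ∈ A, -z ∈ A) (h : Rel A x y) : Rel A y x := by
  rcases h with h | h
  · exact Or.inl h.symm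
  · exact Or.inr (by simpa using (h.antipodes hA).symm)

lemma neg_right (h : Rel A x y) : Rel A x (-y) := by
  rcases h with h | h
  · exact Or.inr (by rwa [neg_neg])
  · exact Or.inl h

lemma neg_left (hA : ∀ z ∈ A, -z ∈ A) (h : Rel A x y) : Rel A (-x) y :=
  (h.symm hA).neg_right.symm hA

lemma trans (hA : ∀ z ∈ A, -z ∈ A) (h : Rel A x y) (h' : Rel A y z) : Rel A x z := by
  rcases h with h | h
  · rcases h' with h' | h'
    · exact Or.inl (h.trans h')
    · exact Or.inr (h.trans h')
  · rcases h' with h' | h'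
    · exact Or.inr (h.trans (h'.antipodes hA))
    · exact Or.inl (h.trans (by simpa using h'.antipodes hA))

end Rel

lemma neg_mem_zeros {q : ℕ} (hF : F.IsHomogeneous q) : ∀ z ∈ zeros F, -z ∈ zeros F := by
  intro z hz
  have hz : MvPolynomial.eval (vec z) F = 0 := hz
  have := hF.eval_smul (-1) (vec z)
  simp only [zeros, mem_ofPred_eq, vec_neg]
  rw [hz, neg_one_smul, mul_zero] at this
  exact this

lemma neg_mem_nonneg {q : ℕ} (hq : Even q) (hF : F.IsHomogeneous q) :
    ∀ z ∈ nonneg F, -z ∈ nonneg F := by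
  intro z hz
  have := hF.eval_smul (-1) (vec z)
  simp only [nonneg, mem_ofPred_eq, vec_neg] at hz ⊢
  rw [neg_one_smul, hq.neg_one_pow, one_mul] at this
  rwa [this]

lemma neg_mem_nonneg_neg {q : ℕ} (hq : Odd q) (hF : F.IsHomogeneous q) :
    ∀ z ∈ nonneg F, -z ∈ nonneg (-F) := by
  intro z hz
  have := hF.eval_smul (-1) (vec z)
  simp only [nonneg, mem_ofPred_eq, vec_neg, map_neg] at hz ⊢
  rw [neg_one_smul, hq.neg_one_pow] at this
  linarith

/-- In even degree, points related in both closed regions are related in the zero set. -/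
lemma rel_zeros_of_rel_nonneg {q : ℕ} (hq : Even q) (hF : F.IsHomogeneous q)
    (h1 : Rel (nonneg F) x y) (h2 : Rel (nonneg (-F)) x y) : Rel (zeros F) x y := by
  have hp := neg_mem_nonneg hq hF
  have hn := neg_mem_nonneg hq hF.neg
  have key : ∀ {y : S2}, Linked (nonneg F) x y → Linked (nonneg (-F)) x (-y) →
      Rel (zeros F) x y := by
    intro y h1 h2
    have h2' : Linked (nonneg (-F)) y (-x) := by simpa using (h2.antipodes hn).symm
    rcases linked_zeros_of_four_cycle h1 h2' (h1.antipodes hp) h2.symm with h | h | h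
    · exact Or.inl h
    · exact Or.inl (linked_zeros_of_two_cycle h1 (h.nonneg_neg_of_zeros.trans h2'.symm))
    · exact Or.inr h
  rcases h1 with h1 | h1 <;> rcases h2 with h2 | h2
  · exact Or.inl (linked_zeros_of_two_cycle h1 h2)
  · exact key h1 h2
  · simpa using (key h1 (by rwa [neg_neg])).neg_right
  · exact Or.inr (linked_zeros_of_two_cycle h1 h2)

lemma linked_nonneg_of_cone (hxy : y ≠ -x)
    (h : ∀ s t : ℝ, 0 ≤ s → 0 ≤ t → 0 ≤ MvPolynomial.eval (s • vec x + t • vec y) F) :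
    Linked (nonneg F) x y :=
  linked_of_cone hxy fun s t hs ht z hz ↦ by
    rw [nonneg, mem_ofPred_eq, hz]
    exact h s t hs ht

lemma linked_nonneg_neg_of_cone (hxy : y ≠ -x)
    (h : ∀ s t : ℝ, 0 ≤ s → 0 ≤ t → MvPolynomial.eval (s • vec x + t • vec y) F ≤ 0) :
    Linked (nonneg (-F)) x y :=
  linked_nonneg_of_cone hxy fun s t hs ht ↦ by simpa using h s t hs ht

/-- Two points on a real line are related in it. -/
lemma rel_zeros_of_degree_one (hF : F.IsHomogeneous 1) (hx : x ∈ zeros F) (hy : y ∈ zeros F) :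
    Rel (zeros F) x y := by
  by_cases hxy : y = -x
  · rw [hxy]
    exact (Rel.refl hx).neg_right
  refine Or.inl (linked_of_cone hxy fun s t _ _ z hz ↦ ?_)
  obtain ⟨c, hc⟩ := hF.exists_binary_form (vec x) (vec y)
  have h0 : MvPolynomial.eval (vec x) F = 0 := hx
  have h1 : MvPolynomial.eval (vec y) F = 0 := hy
  have e0 := hc 1 0
  have e1 := hc 0 1
  simp [Finset.sum_range_succ, h0, h1] at e0 e1
  rw [zeros, mem_ofPred_eq, hz, hc]
  simp [Finset.sum_range_succ, ← e0, ← e1]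

/-- Two points on a real conic are related in it. -/
lemma rel_zeros_of_degree_two (hF : F.IsHomogeneous 2) (hx : x ∈ zeros F) (hy : y ∈ zeros F) :
    Rel (zeros F) x y := by
  by_cases hxy : y = -x
  · rw [hxy]
    exact (Rel.refl hx).neg_right
  by_cases hxy' : y = x
  · rw [hxy']
    exact Rel.refl hx
  obtain ⟨c, hc⟩ := hF.exists_binary_form (vec x) (vec y)
  have h0 : MvPolynomial.eval (vec x) F = 0 := hx
  have h1 : MvPolynomial.eval (vec y) F = 0 := hy
  have e0 := hc 1 0
  have e1 := hc 0 1
  simp [Finset.sum_range_succ, h0, h1] at e0 e1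
  have hg : ∀ s t : ℝ, MvPolynomial.eval (s • vec x + t • vec y) F = c 1 * (s * t) := by
    intro s t
    rw [hc]
    simp [Finset.sum_range_succ, ← e0, ← e1]
    ring
  have hg' : ∀ s t : ℝ, MvPolynomial.eval (s • vec x + t • vec (-y)) F = -(c 1 * (s * t)) := by
    intro s t
    rw [vec_neg, smul_neg, ← neg_smul, hg]
    ring
  have hxn : -y ≠ -x := fun h ↦ hxy' (neg_injective h)
  apply rel_zeros_of_rel_nonneg even_two hF
  · rcases le_total 0 (c 1) with h | h
    · exact Or.inl (linked_nonneg_of_cone hxy fun s t hs ht ↦ by rw [hg]; positivity)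
    · refine Or.inr (linked_nonneg_of_cone hxn fun s t hs ht ↦ ?_)
      rw [hg', ← neg_mul]
      exact mul_nonneg (by linarith) (by positivity)
  · rcases le_total 0 (c 1) with h | h
    · refine Or.inr (linked_nonneg_neg_of_cone hxn fun s t hs ht ↦ ?_)
      rw [hg', neg_nonpos]
      positivity
    · refine Or.inl (linked_nonneg_neg_of_cone hxy fun s t hs ht ↦ ?_)
      rw [hg]
      exact mul_nonpos_of_nonpos_of_nonneg h (by positivity)

end S2

namespace S2

variable {F : MvPolynomial (Fin 3) ℝ} {x y z : S2}

/-- Two unrelated zeros of a cubic: at least one of them is linked to its antipode, under a sign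
normalization of the points. -/
lemma rel_zeros_or_of_degree_three_of_nonneg (hF : F.IsHomogeneous 3) (hxy : y ≠ x)
    (hxy' : y ≠ -x) {α β : ℝ} (hα : 0 ≤ α) (hβ : 0 ≤ β)
    (hg : ∀ s t : ℝ, MvPolynomial.eval (s • vec x + t • vec y) F = s * t * (α * s + β * t)) :
    (Rel (zeros F) x y ∨ Linked (zeros F) x (-x) ∨ Linked (zeros F) y (-y)) ∧
      (Linked (zeros F) x (-x) → Linked (zeros F) y (-y) → Rel (zeros F) x y) := by
  have hpn := neg_mem_nonneg_neg (by decide) hF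
  have hnp : ∀ z ∈ nonneg (-F), -z ∈ nonneg F := by
    simpa using neg_mem_nonneg_neg (by decide) hF.neg
  have hp : Linked (nonneg F) x y :=
    linked_nonneg_of_cone hxy' fun s t hs ht ↦ by rw [hg]; positivity
  refine ⟨?_, fun hx hy ↦ Or.inl (linked_zeros_of_two_cycle hp ?_)⟩
  swap
  · exact (hx.nonneg_neg_of_zeros.trans (hp.antipodes hpn)).trans hy.nonneg_neg_of_zeros.symm
  by_cases h0 : α = 0 ∧ β = 0
  · refine Or.inl (Or.inl (linked_zeros_of_two_cycle hp ?_))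
    exact linked_nonneg_neg_of_cone hxy' fun s t hs ht ↦ by rw [hg]; simp [h0]
  obtain ⟨w, c, hc, hw⟩ := exists_vec_eq_smul (u := (-β) • vec x + α • vec y) (fun h ↦ by
    have := eq_zero_of_smul_add_smul hxy hxy' h
    exact h0 ⟨this.2, by linarith [this.1]⟩)
  have hyw : Linked (nonneg (-F)) y w := by
    refine linked_nonneg_neg_of_cone (fun h ↦ ?_) fun s t hs ht ↦ ?_
    · have e : (-(c * β)) • vec x + (c * α + 1) • vec y = 0 := by
        have : vec w + vec y = 0 := by rw [h, vec_neg, neg_add_cancel]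
        rw [← this, hw]
        module
      have := (eq_zero_of_smul_add_smul hxy hxy' e).2
      nlinarith [mul_nonneg hc.le hα]
    · have e : s • vec y + t • vec w = (-(t * c * β)) • vec x + (s + t * c * α) • vec y := by
        rw [hw]
        module
      rw [e, hg]
      have : -(t * c * β) * (s + t * c * α) * (α * -(t * c * β) + β * (s + t * c * α)) =
        -((t * c * β) * (s + t * c * α) * (β * s)) := by ring
      rw [this, neg_nonpos]
      positivity
  have hwx : Linked (nonneg F) w (-x) := by
    refine linked_nonneg_of_cone (fun h ↦ ?_) fun s t hs ht ↦ ?_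
    · have e : (-(c * β) - 1) • vec x + (c * α) • vec y = 0 := by
        have : vec w - vec x = 0 := by rw [neg_injective h, sub_self]
        rw [← this, hw]
        module
      have := (eq_zero_of_smul_add_smul hxy hxy' e).1
      nlinarith [mul_nonneg hc.le hβ]
    · have e : s • vec w + t • vec (-x) = (-(s * c * β + t)) • vec x + (s * c * α) • vec y := by
        rw [hw, vec_neg]
        module
      rw [e, hg]
      have : -(s * c * β + t) * (s * c * α) * (α * -(s * c * β + t) + β * (s * c * α)) =
        (s * c * β + t) * (s * c * α) * (α * t) := by ring
      rw [this]
      positivity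
  have hwx' : Linked (nonneg (-F)) (-w) x := by simpa using hwx.antipodes hpn
  rcases linked_zeros_of_six_cycle hp hyw hwx (hp.antipodes hpn) (hyw.antipodes hnp) hwx'
    with h | h | h | h | h
  · exact Or.inl (Or.inl h)
  · exact Or.inl (Or.inl (linked_zeros_of_two_cycle hp (h.nonneg_neg_of_zeros.trans hyw.symm)))
  · exact Or.inr (Or.inl h)
  · exact Or.inl (Or.inr h)
  · have hyy : Linked (nonneg F) y (-y) :=
      (hp.symm.trans h.nonneg_of_zeros).trans (hyw.antipodes hnp).symm
    refine Or.inr (Or.inr (linked_zeros_of_two_cycle hyy ?_))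
    simpa using (hyy.antipodes hpn).symm

lemma rel_zeros_or_of_degree_three (hF : F.IsHomogeneous 3) (hx : x ∈ zeros F)
    (hy : y ∈ zeros F) :
    (Rel (zeros F) x y ∨ Linked (zeros F) x (-x) ∨ Linked (zeros F) y (-y)) ∧
      (Linked (zeros F) x (-x) → Linked (zeros F) y (-y) → Rel (zeros F) x y) := by
  have hz := neg_mem_zeros hF
  by_cases hxy' : y = -x
  · have : Rel (zeros F) x y := by
      rw [hxy']
      exact (Rel.refl hx).neg_right
    exact ⟨Or.inl this, fun _ _ ↦ this⟩
  by_cases hxy : y = x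
  · have : Rel (zeros F) x y := by
      rw [hxy]
      exact Rel.refl hx
    exact ⟨Or.inl this, fun _ _ ↦ this⟩
  obtain ⟨c, hc⟩ := hF.exists_binary_form (vec x) (vec y)
  have h0 : MvPolynomial.eval (vec x) F = 0 := hx
  have h1 : MvPolynomial.eval (vec y) F = 0 := hy
  have e0 := hc 1 0
  have e1 := hc 0 1
  simp [Finset.sum_range_succ, h0, h1] at e0 e1
  have hg : ∀ s t : ℝ, MvPolynomial.eval (s • vec x + t • vec y) F =
      s * t * (c 1 * s + c 2 * t) := by
    intro s t
    rw [hc]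
    simp [Finset.sum_range_succ, ← e0, ← e1]
    ring
  have hxn : -y ≠ -x := fun h ↦ hxy (neg_injective h)
  have hxn' : -y ≠ x := fun h ↦ hxy' (by rw [← h, neg_neg])
  have hRl : Rel (zeros F) (-x) y → Rel (zeros F) x y := fun h ↦ by simpa using h.neg_left hz
  have hRr : Rel (zeros F) x (-y) → Rel (zeros F) x y := fun h ↦ by simpa using h.neg_right
  have hRlr : Rel (zeros F) (-x) (-y) → Rel (zeros F) x y := fun h ↦
    hRl (by simpa using h.neg_right)
  have hs : ∀ u : S2, Linked (zeros F) (-u) (- -u) ↔ Linked (zeros F) u (-u) := fun u ↦ by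
    rw [neg_neg]
    exact ⟨Linked.symm, Linked.symm⟩
  rcases le_total 0 (c 1) with hα | hα <;> rcases le_total 0 (c 2) with hβ | hβ
  · exact rel_zeros_or_of_degree_three_of_nonneg hF hxy hxy' hα hβ hg
  · have := rel_zeros_or_of_degree_three_of_nonneg (x := -x) (y := y) hF
      (fun h ↦ hxy' h) (by rwa [neg_neg]) (α := c 1) (β := -c 2) hα (by linarith)
      (fun s t ↦ by rw [vec_neg, smul_neg, ← neg_smul, hg]; ring)
    rw [hs] at this
    tauto
  · have := rel_zeros_or_of_degree_three_of_nonneg (x := x) (y := -y) hF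
      hxn' hxn (α := -c 1) (β := c 2) (by linarith) hβ
      (fun s t ↦ by rw [vec_neg, smul_neg, ← neg_smul, hg]; ring)
    rw [hs] at this
    tauto
  · have := rel_zeros_or_of_degree_three_of_nonneg (x := -x) (y := -y) hF
      hxn (by rwa [neg_neg]) (α := -c 1) (β := -c 2) (by linarith) (by linarith)
      (fun s t ↦ by rw [vec_neg, vec_neg, smul_neg, smul_neg, ← neg_smul, ← neg_smul, hg]; ring)
    rw [hs, hs] at this
    tauto

/-- Among three zeros of a cubic, two are related in the zero set. -/
lemma rel_zeros_of_degree_three (hF : F.IsHomogeneous 3) (hx : x ∈ zeros F) (hy : y ∈ zeros F)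
    (hz : z ∈ zeros F) : Rel (zeros F) x y ∨ Rel (zeros F) z x ∨ Rel (zeros F) z y := by
  have h1 := rel_zeros_or_of_degree_three hF hx hy
  have h2 := rel_zeros_or_of_degree_three hF hz hx
  have h3 := rel_zeros_or_of_degree_three hF hz hy
  grind

lemma rel_nonneg_of_degree_four_of_nonneg (hxy : y ≠ x) (hxy' : y ≠ -x) {α β γ : ℝ}
    (hα : 0 ≤ α) (hγ : 0 ≤ γ)
    (hg : ∀ s t : ℝ, MvPolynomial.eval (s • vec x + t • vec y) F =
      s * t * (α * s ^ 2 + β * (s * t) + γ * t ^ 2)) :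
    Rel (nonneg F) x y ∨ Rel (nonneg (-F)) x y := by
  rcases le_total 0 β with hβ | hβ
  · exact Or.inl (Or.inl (linked_nonneg_of_cone hxy' fun s t hs ht ↦ by rw [hg]; positivity))
  · refine Or.inr (Or.inr (linked_nonneg_neg_of_cone (fun h ↦ hxy (neg_injective h))
      fun s t hs ht ↦ ?_))
    rw [vec_neg, smul_neg, ← neg_smul, hg]
    have : s * -t * (α * s ^ 2 + β * (s * -t) + γ * (-t) ^ 2) =
      -(s * t * (α * s ^ 2 + -β * (s * t) + γ * t ^ 2)) := by ring
    have hβ' : 0 ≤ -β := by linarith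
    rw [this, neg_nonpos]
    positivity

lemma exists_factorization {α β γ : ℝ} (hα : 0 < α) (hγ : γ < 0) :
    ∃ κ σ τ : ℝ, 0 < κ ∧ 0 < σ ∧ 0 < τ ∧
      ∀ s t : ℝ, α * s ^ 2 + β * (s * t) + γ * t ^ 2 = κ * (τ * s - t) * (σ * s + t) := by
  have hD : β ^ 2 < β ^ 2 - 4 * α * γ := by nlinarith
  have hsq : |β| < √(β ^ 2 - 4 * α * γ) := by
    rw [← Real.sqrt_sq_eq_abs]
    exact Real.sqrt_lt_sqrt (sq_nonneg _) hD
  have hr : √(β ^ 2 - 4 * α * γ) ^ 2 = β ^ 2 - 4 * α * γ :=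
    Real.sq_sqrt (by nlinarith [sq_nonneg β])
  set r := √(β ^ 2 - 4 * α * γ)
  obtain ⟨h1, h2⟩ := abs_lt.mp hsq
  refine ⟨-γ, (r - β) / (2 * -γ), (r + β) / (2 * -γ), by linarith,
    div_pos (by linarith) (by linarith), div_pos (by linarith) (by linarith), fun s t ↦ ?_⟩
  have hγ' : γ ≠ 0 := hγ.ne
  field_simp
  linear_combination s ^ 2 * hr

lemma rel_nonneg_of_degree_four_of_pos_of_neg (hF : F.IsHomogeneous 4) (hxy : y ≠ x)
    (hxy' : y ≠ -x) {α β γ : ℝ} (hα : 0 < α) (hγ : γ < 0)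
    (hg : ∀ s t : ℝ, MvPolynomial.eval (s • vec x + t • vec y) F =
      s * t * (α * s ^ 2 + β * (s * t) + γ * t ^ 2)) :
    Rel (nonneg F) x y ∨ Rel (nonneg (-F)) x y := by
  obtain ⟨κ, σ, τ, hκ, hσ, hτ, hfac⟩ := exists_factorization (β := β) hα hγ
  replace hg : ∀ s t : ℝ, MvPolynomial.eval (s • vec x + t • vec y) F =
      κ * (s * t * (τ * s - t) * (σ * s + t)) := fun s t ↦ by
    rw [hg, hfac]
    ring
  have hind : ∀ {s t : ℝ}, s • vec x + t • vec y = 0 → s = 0 ∧ t = 0 :=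
    eq_zero_of_smul_add_smul hxy hxy'
  have hp := neg_mem_nonneg (by decide) hF
  have hn := neg_mem_nonneg (by decide) hF.neg
  obtain ⟨u, c, hc, hu⟩ := exists_vec_eq_smul (u := (1 : ℝ) • vec x + τ • vec y)
    (fun h ↦ one_ne_zero (hind h).1)
  obtain ⟨v, d, hd, hv⟩ := exists_vec_eq_smul (u := (-1 : ℝ) • vec x + σ • vec y)
    (fun h ↦ by simpa using (hind h).1)
  have hxu : Linked (nonneg F) x u := by
    refine linked_nonneg_of_cone (fun h ↦ ?_) fun s t hs ht ↦ ?_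
    · have e : (c + 1) • vec x + (c * τ) • vec y = 0 := by
        have : vec u + vec x = 0 := by rw [h, vec_neg, neg_add_cancel]
        rw [← this, hu]
        module
      linarith [(hind e).1]
    · have e : s • vec x + t • vec u = (s + t * c) • vec x + (t * c * τ) • vec y := by
        rw [hu]
        module
      rw [e, hg, show τ * (s + t * c) - t * c * τ = τ * s by ring]
      positivity
  have huy : Linked (nonneg (-F)) u y := by
    refine linked_nonneg_neg_of_cone (fun h ↦ ?_) fun s t hs ht ↦ ?_
    · have e : c • vec x + (c * τ + 1) • vec y = 0 := by
        have : vec u + vec y = 0 := by rw [h, vec_neg, add_neg_cancel]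
        rw [← this, hu]
        module
      linarith [(hind e).1]
    · have e : s • vec u + t • vec y = (s * c) • vec x + (s * c * τ + t) • vec y := by
        rw [hu]
        module
      rw [e, hg, show τ * (s * c) - (s * c * τ + t) = -t by ring, mul_neg, neg_mul, mul_neg,
        neg_nonpos]
      positivity
  have hyv : Linked (nonneg F) y v := by
    refine linked_nonneg_of_cone (fun h ↦ ?_) fun s t hs ht ↦ ?_
    · have e : (-d) • vec x + (d * σ + 1) • vec y = 0 := by
        have : vec v + vec y = 0 := by rw [h, vec_neg, neg_add_cancel]
        rw [← this, hv]
        module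
      linarith [(hind e).1]
    · have e : s • vec y + t • vec v = (-(t * d)) • vec x + (s + t * d * σ) • vec y := by
        rw [hv]
        module
      rw [e, hg, show κ * (-(t * d) * (s + t * d * σ) * (τ * -(t * d) - (s + t * d * σ)) *
        (σ * -(t * d) + (s + t * d * σ))) =
        κ * (t * d * (s + t * d * σ) * (τ * (t * d) + (s + t * d * σ)) * s) by ring]
      positivity
  have hvx : Linked (nonneg (-F)) v (-x) := by
    refine linked_nonneg_neg_of_cone (fun h ↦ ?_) fun s t hs ht ↦ ?_
    · have e : (-d - 1) • vec x + (d * σ) • vec y = 0 := by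
        have : vec v - vec x = 0 := by rw [neg_injective h, sub_self]
        rw [← this, hv]
        module
      linarith [(hind e).1]
    · have e : s • vec v + t • vec (-x) = (-(s * d + t)) • vec x + (s * d * σ) • vec y := by
        rw [hv, vec_neg]
        module
      rw [e, hg, show κ * (-(s * d + t) * (s * d * σ) * (τ * -(s * d + t) - s * d * σ) *
        (σ * -(s * d + t) + s * d * σ)) =
        -(κ * ((s * d + t) * (s * d * σ) * (τ * (s * d + t) + s * d * σ) * (σ * t))) by ring,
        neg_nonpos]
      positivity
  have hvx' : Linked (nonneg (-F)) (-v) x := by simpa using hvx.antipodes hn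
  rcases linked_zeros_of_eight_cycle hxu huy hyv hvx (hxu.antipodes hp) (huy.antipodes hn)
    (hyv.antipodes hp) hvx' with h | h | h | h | h | h | h
  · exact Or.inr (Or.inl (h.nonneg_neg_of_zeros.trans huy))
  · exact Or.inl (Or.inl h.nonneg_of_zeros)
  · exact Or.inl (Or.inl (h.nonneg_of_zeros.trans hyv.symm))
  · have hvx'' : Linked (nonneg (-F)) v x := hvx.trans h.nonneg_neg_of_zeros.symm
    rcases linked_zeros_of_four_cycle hxu huy hyv hvx'' with h | h | h
    · exact Or.inr (Or.inl (h.nonneg_neg_of_zeros.trans huy))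
    · exact Or.inl (Or.inl h.nonneg_of_zeros)
    · exact Or.inl (Or.inl (h.nonneg_of_zeros.trans hyv.symm))
  · exact Or.inr (Or.inr (h.nonneg_neg_of_zeros.trans (huy.antipodes hn)))
  · exact Or.inl (Or.inr h.nonneg_of_zeros)
  · exact Or.inl (Or.inr (h.nonneg_of_zeros.trans (hyv.antipodes hp).symm))

/-- Two zeros of a quartic are related in the nonnegative or in the nonpositive region. -/
lemma rel_nonneg_of_degree_four (hF : F.IsHomogeneous 4) (hx : x ∈ zeros F) (hy : y ∈ zeros F) :
    Rel (nonneg F) x y ∨ Rel (nonneg (-F)) x y := by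
  by_cases hxy' : y = -x
  · rw [hxy']
    exact Or.inl (Rel.refl (Linked.refl hx).nonneg_of_zeros.left_mem).neg_right
  by_cases hxy : y = x
  · rw [hxy]
    exact Or.inl (Rel.refl (Linked.refl hx).nonneg_of_zeros.left_mem)
  obtain ⟨c, hc⟩ := hF.exists_binary_form (vec x) (vec y)
  have h0 : MvPolynomial.eval (vec x) F = 0 := hx
  have h1 : MvPolynomial.eval (vec y) F = 0 := hy
  have e0 := hc 1 0
  have e1 := hc 0 1
  simp [Finset.sum_range_succ, h0, h1] at e0 e1
  have hg : ∀ s t : ℝ, MvPolynomial.eval (s • vec x + t • vec y) F =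
      s * t * (c 1 * s ^ 2 + c 2 * (s * t) + c 3 * t ^ 2) := by
    intro s t
    rw [hc]
    simp [Finset.sum_range_succ, ← e0, ← e1]
    ring
  have hg' : ∀ s t : ℝ, MvPolynomial.eval (s • vec x + t • vec y) (-F) =
      s * t * (-c 1 * s ^ 2 + -c 2 * (s * t) + -c 3 * t ^ 2) := by
    intro s t
    rw [map_neg, hg]
    ring
  rcases lt_or_ge 0 (c 1) with hα | hα <;> rcases lt_or_ge (c 3) 0 with hγ | hγ
  · exact rel_nonneg_of_degree_four_of_pos_of_neg hF hxy hxy' hα hγ hg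
  · exact rel_nonneg_of_degree_four_of_nonneg hxy hxy' hα.le hγ hg
  · have := rel_nonneg_of_degree_four_of_nonneg hxy hxy' (by linarith) (by linarith) hg'
    rw [neg_neg] at this
    exact this.symm
  · rcases hα.lt_or_eq with hα | hα
    · rcases hγ.lt_or_eq with hγ | hγ
      · have := rel_nonneg_of_degree_four_of_pos_of_neg hF.neg hxy hxy' (by linarith)
          (by linarith) hg'
        rw [neg_neg] at this
        exact this.symm
      · have := rel_nonneg_of_degree_four_of_nonneg hxy hxy' (by linarith) (by linarith) hg'
        rw [neg_neg] at this
        exact this.symm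
    · exact rel_nonneg_of_degree_four_of_nonneg hxy hxy' hα.ge hγ hg

end S2

/-- Through `n` points there are `k` independent curves of degree `q` if `k + n` does not exceed
the number of monomials. -/
lemma exists_linearIndependent_vanishing {q n k : ℕ}
    (h : k + n ≤ (Finset.Nat.antidiagonalTuple 3 q).card) (v : Fin n → Fin 3 → ℝ) :
    ∃ G : Fin k → MvPolynomial (Fin 3) ℝ, LinearIndependent ℝ G ∧ (∀ i, (G i).IsHomogeneous q) ∧
      ∀ i j, MvPolynomial.eval (v j) (G i) = 0 := by
  let ι := {d // d ∈ Finset.Nat.antidiagonalTuple 3 q}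
  let e : ι → (Fin 3 →₀ ℕ) := fun d ↦ Finsupp.equivFunOnFinite.symm d.1
  have he : Function.Injective e :=
    Finsupp.equivFunOnFinite.symm.injective.comp Subtype.val_injective
  let m : ι → MvPolynomial (Fin 3) ℝ := MvPolynomial.basisMonomials (Fin 3) ℝ ∘ e
  have hm : LinearIndependent ℝ m := (MvPolynomial.basisMonomials _ ℝ).linearIndependent.comp e he
  let Φ : (ι → ℝ) →ₗ[ℝ] MvPolynomial (Fin 3) ℝ := Fintype.linearCombination ℝ m
  have hΦ : Φ.ker = ⊥ := LinearMap.ker_eq_bot.mpr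
    (linearIndependent_iff_injective_fintypeLinearCombination.mp hm)
  have hΦq : ∀ c, (Φ c).IsHomogeneous q := by
    intro c
    rw [Fintype.linearCombination_apply]
    refine MvPolynomial.IsHomogeneous.sum _ _ _ fun d _ ↦ ?_
    refine (MvPolynomial.homogeneousSubmodule (Fin 3) ℝ q).smul_mem _ ?_
    rw [MvPolynomial.mem_homogeneousSubmodule]
    simp only [m, Function.comp_apply, MvPolynomial.coe_basisMonomials]
    refine MvPolynomial.isHomogeneous_monomial _ ?_
    rw [Finsupp.degree_eq_sum]
    exact Finset.Nat.mem_antidiagonalTuple.mp d.2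
  let Ψ : (ι → ℝ) →ₗ[ℝ] (Fin n → ℝ) :=
    LinearMap.pi fun j ↦ (MvPolynomial.aeval (R := ℝ) (v j)).toLinearMap ∘ₗ Φ
  have hker : k ≤ Module.finrank ℝ Ψ.ker := by
    have h1 := LinearMap.finrank_range_add_finrank_ker Ψ
    have h2 : Module.finrank ℝ Ψ.range ≤ n := by simpa using Submodule.finrank_le Ψ.range
    have h3 : Module.finrank ℝ (ι → ℝ) = (Finset.Nat.antidiagonalTuple 3 q).card := by
      rw [Module.finrank_fintype_fun_eq_card, Fintype.card_coe]
    omega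
  obtain ⟨f, hf⟩ := exists_linearIndependent_of_le_finrank hker
  refine ⟨fun i ↦ Φ (f i), ?_, fun i ↦ hΦq _, fun i j ↦ ?_⟩
  · exact (hf.map' Ψ.ker.subtype (Submodule.ker_subtype _)).map' Φ hΦ
  · have := congrFun (LinearMap.mem_ker.mp (f i).2) j
    simpa [Ψ, MvPolynomial.aeval_eq_eval] using this

lemma exists_mem_inter_of_isClosed {X : Type*} [TopologicalSpace X] [PreconnectedSpace X]
    {A B : Set X} (hA : IsClosed A) (hB : IsClosed B) (hAB : ∀ x, x ∈ A ∨ x ∈ B)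
    (hA' : A.Nonempty) (hB' : B.Nonempty) : ∃ x, x ∈ A ∧ x ∈ B := by
  obtain ⟨x, -, hx⟩ := isPreconnected_closed_iff.mp (isPreconnected_univ (α := X)) A B hA hB
    (fun x _ ↦ hAB x) (by simpa using hA') (by simpa using hB')
  exact ⟨x, hx⟩

namespace S2

instance : PreconnectedSpace S2 := by
  rw [← isPreconnected_iff_preconnectedSpace]
  refine isPreconnected_sphere ?_ _ _
  rw [← Module.finrank_eq_rank, finrank_euclideanSpace_fin]
  norm_num

/-- The members of the pencil spanned by two polynomials, parametrized by the circle. -/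
def pencil (F₀ F₁ : MvPolynomial (Fin 3) ℝ) (z : Circle) : MvPolynomial (Fin 3) ℝ :=
  (z : ℂ).re • F₀ + (z : ℂ).im • F₁

variable {F₀ F₁ : MvPolynomial (Fin 3) ℝ}

lemma eval_pencil (z : Circle) (u : Fin 3 → ℝ) : MvPolynomial.eval u (pencil F₀ F₁ z) =
    (z : ℂ).re * MvPolynomial.eval u F₀ + (z : ℂ).im * MvPolynomial.eval u F₁ := by
  simp [pencil, MvPolynomial.smul_eval]

lemma pencil_neg (z : Circle) : pencil F₀ F₁ (-z) = -pencil F₀ F₁ z := by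
  simp [pencil, add_comm]

lemma isHomogeneous_pencil {q : ℕ} (h₀ : F₀.IsHomogeneous q) (h₁ : F₁.IsHomogeneous q)
    (z : Circle) : (pencil F₀ F₁ z).IsHomogeneous q :=
  (MvPolynomial.homogeneousSubmodule (Fin 3) ℝ q).add_mem
    (Submodule.smul_mem _ _ h₀) (Submodule.smul_mem _ _ h₁)

lemma continuous_eval_pencil (F₀ F₁ : MvPolynomial (Fin 3) ℝ) :
    Continuous fun r : Circle × S2 ↦ MvPolynomial.eval (vec r.2) (pencil F₀ F₁ r.1) := by
  simp only [eval_pencil]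
  have h : ∀ F : MvPolynomial (Fin 3) ℝ,
      Continuous fun r : Circle × S2 ↦ MvPolynomial.eval (vec r.2) F :=
    fun F ↦ (MvPolynomial.continuous_eval F).comp (continuous_vec.comp continuous_snd)
  have hz : Continuous fun r : Circle × S2 ↦ (r.1 : ℂ) :=
    continuous_subtype_val.comp continuous_fst
  exact ((Complex.continuous_re.comp hz).mul (h F₀)).add
    ((Complex.continuous_im.comp hz).mul (h F₁))

lemma isClosed_setOf_rel {P : Type*} [TopologicalSpace P] {C : Set (P × S2)} (hC : IsClosed C) :
    IsClosed {r : P × S2 × S2 | Rel {u | (r.1, u) ∈ C} r.2.1 r.2.2} :=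
  (isClosed_setOf_linked hC).union ((isClosed_setOf_linked hC).preimage
    (f := fun r : P × S2 × S2 ↦ (r.1, r.2.1, -r.2.2)) (by fun_prop))

lemma isClosed_setOf_rel_nonneg_pencil (x y : S2) :
    IsClosed {z | Rel (nonneg (pencil F₀ F₁ z)) x y} :=
  (isClosed_setOf_rel (isClosed_le continuous_const (continuous_eval_pencil F₀ F₁))).preimage
    (f := fun z ↦ (z, x, y)) (by fun_prop)

lemma isClosed_setOf_rel_zeros_pencil (y : S2) :
    IsClosed {r : Circle × S2 | Rel (zeros (pencil F₀ F₁ r.1)) r.2 y} :=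
  (isClosed_setOf_rel (isClosed_eq (continuous_eval_pencil F₀ F₁) continuous_const)).preimage
    (f := fun r : Circle × S2 ↦ (r.1, r.2, y)) (by fun_prop)

lemma mem_zeros_pencil {x : S2} (h₀ : x ∈ zeros F₀) (h₁ : x ∈ zeros F₁) (z : Circle) :
    x ∈ zeros (pencil F₀ F₁ z) := by
  have h₀ : MvPolynomial.eval (vec x) F₀ = 0 := h₀
  have h₁ : MvPolynomial.eval (vec x) F₁ = 0 := h₁
  rw [zeros, mem_ofPred_eq, eval_pencil, h₀, h₁]
  simp

lemma exists_mem_zeros_pencil (F₀ F₁ : MvPolynomial (Fin 3) ℝ) (x : S2) :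
    ∃ z, x ∈ zeros (pencil F₀ F₁ z) := by
  set w : ℂ := ⟨MvPolynomial.eval (vec x) F₁, -MvPolynomial.eval (vec x) F₀⟩ with hw
  by_cases h : w = 0
  · refine ⟨1, mem_zeros_pencil ?_ ?_ _⟩
    · simpa [hw, zeros] using congrArg Complex.im h
    · simpa [hw, zeros] using congrArg Complex.re h
  · have hn : ‖w‖ ≠ 0 := norm_ne_zero_iff.mpr h
    obtain ⟨z, hz⟩ : ∃ z : Circle, (z : ℂ) = ‖w‖⁻¹ • w := by
      have : ‖w‖⁻¹ • w ∈ Metric.sphere (0 : ℂ) 1 := by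
        rw [mem_sphere_zero_iff_norm, norm_smul, norm_inv, norm_norm, inv_mul_cancel₀ hn]
      exact ⟨⟨_, this⟩, rfl⟩
    refine ⟨z, ?_⟩
    rw [zeros, mem_ofPred_eq, eval_pencil, hz]
    simp only [Complex.smul_re, Complex.smul_im, hw, smul_eq_mul]
    ring

lemma _root_.Circle.eq_or_eq_neg_of_orthogonal {z z' : Circle} {a b : ℝ} (hab : a ≠ 0 ∨ b ≠ 0)
    (h : (z : ℂ).re * a + (z : ℂ).im * b = 0) (h' : (z' : ℂ).re * a + (z' : ℂ).im * b = 0) :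
    z' = z ∨ z' = -z := by
  have hz := Circle.normSq_coe z
  have hz' := Circle.normSq_coe z'
  rw [Complex.normSq_apply] at hz hz'
  have hdet : (z : ℂ).re * (z' : ℂ).im - (z : ℂ).im * (z' : ℂ).re = 0 := by
    rcases hab with ha | hb
    · apply mul_right_cancel₀ ha
      linear_combination (z' : ℂ).im * h - (z : ℂ).im * h'
    · apply mul_right_cancel₀ hb
      linear_combination (z : ℂ).re * h' - (z' : ℂ).re * h
  set c := (z : ℂ).re * (z' : ℂ).re + (z : ℂ).im * (z' : ℂ).im with hc
  have hre : (z' : ℂ).re = c * (z : ℂ).re := by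
    rw [hc]
    linear_combination (-(z' : ℂ).re) * hz + (-(z : ℂ).im) * hdet
  have him : (z' : ℂ).im = c * (z : ℂ).im := by
    rw [hc]
    linear_combination (-(z' : ℂ).im) * hz + (z : ℂ).re * hdet
  have hc2 : c ^ 2 = 1 := by
    have : c ^ 2 * ((z : ℂ).re * (z : ℂ).re + (z : ℂ).im * (z : ℂ).im) = 1 := by
      rw [← hz', hre, him]
      ring
    rwa [hz, mul_one] at this
  rcases eq_or_eq_neg_of_sq_eq_sq c 1 (by rw [hc2, one_pow]) with h | h
  · exact Or.inl (Circle.ext (Complex.ext (by simp [hre, h]) (by simp [him, h])))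
  · exact Or.inr (Circle.ext (Complex.ext (by simp [hre, h]) (by simp [him, h])))

lemma _root_.forall_or_forall_of_equivalence {ι : Type*} {R S : ι → ι → Prop}
    (hR : Equivalence R) (hS : Equivalence S) (h : ∀ i j, R i j ∨ S i j) :
    (∀ i j, R i j) ∨ ∀ i j, S i j := by
  by_contra! hcon
  obtain ⟨⟨a, b, hab⟩, c, d, hcd⟩ := hcon
  have hcd' : R c d := (h c d).resolve_right hcd
  have hac : R a c := by
    rcases h a c with h1 | h1
    · exact h1
    · rcases h a d with h2 | h2
      · exact hR.trans h2 (hR.symm hcd')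
      · exact absurd (hS.trans (hS.symm h1) h2) hcd
  have hbc : S b c := (h b c).resolve_left fun h1 ↦ hab (hR.trans hac (hR.symm h1))
  have hbd : S b d := (h b d).resolve_left fun h1 ↦
    hab (hR.trans (hR.trans hac hcd') (hR.symm h1))
  exact hcd (hS.trans (hS.symm hbc) hbd)

/-- A pencil of quartics contains a member relating all its base points. -/
lemma exists_rel_zeros_pencil_of_degree_four (h₀ : F₀.IsHomogeneous 4) (h₁ : F₁.IsHomogeneous 4)
    {ι : Type*} (p : ι → S2) (hp₀ : ∀ i, p i ∈ zeros F₀) (hp₁ : ∀ i, p i ∈ zeros F₁) :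
    ∃ z, ∀ i j, Rel (zeros (pencil F₀ F₁ z)) (p i) (p j) := by
  have hF := isHomogeneous_pencil h₀ h₁
  have hz := fun z i ↦ mem_zeros_pencil (hp₀ i) (hp₁ i) z
  let A : Set Circle := {z | ∀ i j, Rel (nonneg (pencil F₀ F₁ z)) (p i) (p j)}
  have hA : IsClosed A := by
    have : A = ⋂ i, ⋂ j, {z | Rel (nonneg (pencil F₀ F₁ z)) (p i) (p j)} := by
      ext
      simp [A]
    rw [this]
    exact isClosed_iInter fun i ↦ isClosed_iInter fun j ↦ isClosed_setOf_rel_nonneg_pencil _ _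
  have hAB : ∀ z, z ∈ A ∨ z ∈ Neg.neg ⁻¹' A := by
    intro z
    have hequiv : ∀ F : MvPolynomial (Fin 3) ℝ, F.IsHomogeneous 4 → (∀ i, p i ∈ nonneg F) →
        Equivalence fun i j ↦ Rel (nonneg F) (p i) (p j) := fun F hF hp ↦
      have hs := neg_mem_nonneg (by decide) hF
      ⟨fun i ↦ Rel.refl (hp i), Rel.symm hs, Rel.trans hs⟩
    have := forall_or_forall_of_equivalence
      (hequiv _ (hF z) fun i ↦ (Linked.refl (hz z i)).nonneg_of_zeros.left_mem)
      (hequiv _ (hF z).neg fun i ↦ (Linked.refl (hz z i)).nonneg_neg_of_zeros.left_mem)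
      (fun i j ↦ rel_nonneg_of_degree_four (hF z) (hz z i) (hz z j))
    rwa [← pencil_neg] at this
  have hne : A.Nonempty := by
    rcases hAB 1 with h | h
    exacts [⟨1, h⟩, ⟨-1, h⟩]
  obtain ⟨z, h1, h2⟩ := exists_mem_inter_of_isClosed hA (hA.preimage continuous_neg) hAB hne
    (hne.preimage neg_surjective)
  refine ⟨z, fun i j ↦ rel_zeros_of_rel_nonneg (by decide) (hF z) (h1 i j) ?_⟩
  rw [← pencil_neg]
  exact h2 i j

/-- A pencil of cubics contains a member relating all its base points. -/
lemma exists_rel_zeros_pencil_of_degree_three (h₀ : F₀.IsHomogeneous 3)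
    (h₁ : F₁.IsHomogeneous 3) {ι : Type*} (p : ι → S2) (hp₀ : ∀ i, p i ∈ zeros F₀)
    (hp₁ : ∀ i, p i ∈ zeros F₁) :
    ∃ z, ∀ i j, Rel (zeros (pencil F₀ F₁ z)) (p i) (p j) := by
  have hF := isHomogeneous_pencil h₀ h₁
  have hz := fun z i ↦ mem_zeros_pencil (hp₀ i) (hp₁ i) z
  have hsymm := fun z ↦ neg_mem_zeros (hF z)
  by_contra! hcon
  have hclosed : ∀ x y : S2, IsClosed {z | Rel (zeros (pencil F₀ F₁ z)) x y} := fun x y ↦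
    (isClosed_setOf_rel_zeros_pencil y).preimage (f := fun z ↦ (z, x)) (by fun_prop)
  obtain ⟨i, j, hij⟩ := hcon 1
  have hunrel : ∀ z, ¬ Rel (zeros (pencil F₀ F₁ z)) (p i) (p j) := by
    intro z₁ hz₁
    let N : Set Circle := ⋂ k, {z | Rel (zeros (pencil F₀ F₁ z)) (p k) (p i)} ∪
      {z | Rel (zeros (pencil F₀ F₁ z)) (p k) (p j)}
    have hN : IsClosed N := isClosed_iInter fun k ↦ (hclosed _ _).union (hclosed _ _)
    have hcov : ∀ z, z ∈ {z | Rel (zeros (pencil F₀ F₁ z)) (p i) (p j)} ∨ z ∈ N := by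
      intro z
      by_cases h : Rel (zeros (pencil F₀ F₁ z)) (p i) (p j)
      · exact Or.inl h
      · refine Or.inr (mem_iInter.mpr fun k ↦ ?_)
        rcases rel_zeros_of_degree_three (hF z) (hz z i) (hz z j) (hz z k) with h' | h' | h'
        exacts [absurd h' h, Or.inl h', Or.inr h']
    obtain ⟨z, hD, hzN⟩ := exists_mem_inter_of_isClosed (hclosed _ _) hN hcov ⟨z₁, hz₁⟩
      ⟨1, (hcov 1).resolve_left hij⟩
    have hall : ∀ k, Rel (zeros (pencil F₀ F₁ z)) (p k) (p i) := by
      intro k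
      rcases mem_iInter.mp hzN k with h | h
      · exact h
      · exact Rel.trans (hsymm z) h (Rel.symm (hsymm z) hD)
    obtain ⟨k, l, hkl⟩ := hcon z
    exact hkl ((hall k).trans (hsymm z) ((hall l).symm (hsymm z)))
  have htri : ∀ z x, x ∈ zeros (pencil F₀ F₁ z) → Rel (zeros (pencil F₀ F₁ z)) x (p i) ∨
      Rel (zeros (pencil F₀ F₁ z)) x (p j) := fun z x hx ↦
    (rel_zeros_of_degree_three (hF z) (hz z i) (hz z j) hx).resolve_left (hunrel z)
  have hno : ∀ z x, Rel (zeros (pencil F₀ F₁ z)) x (p i) →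
      ¬ Rel (zeros (pencil F₀ F₁ z)) x (p j) := fun z x h h' ↦
    hunrel z ((h.symm (hsymm z)).trans (hsymm z) h')
  let U : ι → Set S2 := fun k ↦
    Prod.snd '' {r : Circle × S2 | Rel (zeros (pencil F₀ F₁ r.1)) r.2 (p k)}
  have hU : ∀ k, IsClosed (U k) := fun k ↦
    isClosedMap_snd_of_compactSpace _ (isClosed_setOf_rel_zeros_pencil (p k))
  have hUne : ∀ k, (U k).Nonempty := fun k ↦ ⟨p k, (1, p k), Rel.refl (hz 1 k), rfl⟩
  obtain ⟨x, ⟨⟨z, _⟩, h1, rfl⟩, ⟨⟨z', x⟩, h2, rfl⟩⟩ :=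
    exists_mem_inter_of_isClosed (hU i) (hU j) (fun x ↦ by
      obtain ⟨z, hx⟩ := exists_mem_zeros_pencil F₀ F₁ x
      exact (htri z x hx).imp (fun h ↦ ⟨(z, x), h, rfl⟩) (fun h ↦ ⟨(z, x), h, rfl⟩))
      (hUne i) (hUne j)
  have h1 : Rel (zeros (pencil F₀ F₁ z)) x (p i) := h1
  have h2 : Rel (zeros (pencil F₀ F₁ z')) x (p j) := h2
  by_cases hx : x ∈ zeros F₀ ∧ x ∈ zeros F₁
  · obtain ⟨z, h, h'⟩ := exists_mem_inter_of_isClosed (hclosed x (p i)) (hclosed x (p j))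
      (fun z ↦ htri z x (mem_zeros_pencil hx.1 hx.2 z)) ⟨z, h1⟩ ⟨z', h2⟩
    exact hno z x h h'
  · have hmem : ∀ {z k}, Rel (zeros (pencil F₀ F₁ z)) x (p k) →
        (z : ℂ).re * MvPolynomial.eval (vec x) F₀ + (z : ℂ).im * MvPolynomial.eval (vec x) F₁ = 0 :=
      fun {z k} h ↦ by
        rw [← eval_pencil]
        exact h.elim Linked.left_mem Linked.left_mem
    rcases Circle.eq_or_eq_neg_of_orthogonal (not_and_or.mp hx) (hmem h1) (hmem h2) with h | h
    · exact hno z x h1 (h ▸ h2)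
    · rw [h, pencil_neg, zeros_neg] at h2
      exact hno z x h1 h2

end S2

namespace S2

/-- The quotient map from the sphere to the projective plane. -/
def toRP2 (x : S2) : RP2 := Projectivization.mk ℝ (vec x) (vec_ne_zero x)

lemma continuous_toRP2 : Continuous toRP2 :=
  (continuous_quotient_mk' (s := projectivizationSetoid ℝ (Fin 3 → ℝ))).comp
    (continuous_vec.subtype_mk vec_ne_zero)

lemma toRP2_surjective : Function.Surjective toRP2 := by
  intro p
  obtain ⟨x, c, hc, hx⟩ := exists_vec_eq_smul p.rep_nonzero
  refine ⟨x, ?_⟩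
  rw [← p.mk_rep, toRP2, Projectivization.mk_eq_mk_iff']
  exact ⟨c, hx.symm⟩

lemma toRP2_neg (x : S2) : toRP2 (-x) = toRP2 x := by
  rw [toRP2, toRP2, Projectivization.mk_eq_mk_iff']
  exact ⟨-1, by simp⟩

lemma toRP2_mem_zeroSet {q : ℕ} {F : MvPolynomial (Fin 3) ℝ} (hF : F.IsHomogeneous q) :
    MapsTo toRP2 (zeros F) (zeroSet F) := by
  intro x hx
  have hx : MvPolynomial.eval (vec x) F = 0 := hx
  obtain ⟨a, ha⟩ := Projectivization.exists_smul_eq_mk_rep ℝ (vec x) (vec_ne_zero x)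
  rw [zeroSet, mem_ofPred_eq, toRP2, ← ha, Units.smul_def, hF.eval_smul, hx, mul_zero]

lemma Rel.linked_zeroSet {q : ℕ} {F : MvPolynomial (Fin 3) ℝ} (hF : F.IsHomogeneous q) {x y : S2}
    (h : Rel (zeros F) x y) : Linked (zeroSet F) (toRP2 x) (toRP2 y) := by
  rcases h with h | h
  · exact h.map continuous_toRP2 (toRP2_mem_zeroSet hF)
  · simpa [toRP2_neg] using h.map continuous_toRP2 (toRP2_mem_zeroSet hF)

end S2

/-- Any `n` points of the projective plane are linked in some real curve of degree `q`. -/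
def LinksPoints (q n : ℕ) : Prop :=
  ∀ p : Fin n → RP2, ∃ F : MvPolynomial (Fin 3) ℝ, F ≠ 0 ∧ F.IsHomogeneous q ∧
    ∀ i j, Linked (zeroSet F) (p i) (p j)

namespace LinksPoints

open S2

lemma of_sphere {q n : ℕ} (h : ∀ p : Fin n → S2, ∃ F : MvPolynomial (Fin 3) ℝ, F ≠ 0 ∧
    F.IsHomogeneous q ∧ ∀ i j, Rel (zeros F) (p i) (p j)) : LinksPoints q n := by
  intro p
  choose p' hp' using fun i ↦ toRP2_surjective (p i)
  obtain ⟨F, hF0, hF, hrel⟩ := h p'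
  refine ⟨F, hF0, hF, fun i j ↦ ?_⟩
  rw [← hp' i, ← hp' j]
  exact (hrel i j).linked_zeroSet hF

lemma of_rel {q n : ℕ} (hn : 1 + n ≤ (Finset.Nat.antidiagonalTuple 3 q).card)
    (h : ∀ F : MvPolynomial (Fin 3) ℝ, F.IsHomogeneous q → ∀ x ∈ zeros F, ∀ y ∈ zeros F,
      Rel (zeros F) x y) : LinksPoints q n := by
  refine of_sphere fun p ↦ ?_
  obtain ⟨G, hG, hGq, hGp⟩ := exists_linearIndependent_vanishing hn (vec ∘ p)
  exact ⟨G 0, hG.ne_zero 0, hGq 0, fun i j ↦ h _ (hGq 0) _ (hGp 0 i) _ (hGp 0 j)⟩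

lemma of_pencil {q n : ℕ} (hn : 2 + n ≤ (Finset.Nat.antidiagonalTuple 3 q).card)
    (h : ∀ F₀ F₁ : MvPolynomial (Fin 3) ℝ, F₀.IsHomogeneous q → F₁.IsHomogeneous q →
      ∀ p : Fin n → S2, (∀ i, p i ∈ zeros F₀) → (∀ i, p i ∈ zeros F₁) →
      ∃ z, ∀ i j, Rel (zeros (pencil F₀ F₁ z)) (p i) (p j)) : LinksPoints q n := by
  refine of_sphere fun p ↦ ?_
  obtain ⟨G, hG, hGq, hGp⟩ := exists_linearIndependent_vanishing hn (vec ∘ p)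
  obtain ⟨z, hz⟩ := h (G 0) (G 1) (hGq 0) (hGq 1) p (hGp 0) (hGp 1)
  refine ⟨_, fun h0 ↦ ?_, isHomogeneous_pencil (hGq 0) (hGq 1) z, hz⟩
  have h2 := Fintype.linearIndependent_iff.mp hG ![(z : ℂ).re, (z : ℂ).im]
    (by simpa [Fin.sum_univ_two, pencil] using h0)
  refine Circle.coe_ne_zero z (Complex.ext ?_ ?_)
  · simpa using h2 0
  · simpa using h2 1

lemma mono {q m n : ℕ} (h : LinksPoints q n) (hmn : m ≤ n) (hm : 0 < m) : LinksPoints q m := by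
  intro p
  obtain ⟨F, hF0, hF, hl⟩ := h fun i ↦ if hi : i.1 < m then p ⟨i, hi⟩ else p ⟨0, hm⟩
  refine ⟨F, hF0, hF, fun i j ↦ ?_⟩
  simpa using hl (Fin.castLE hmn i) (Fin.castLE hmn j)

/-- Curves through a common point can be glued. -/
lemma add {a b m n : ℕ} (h : LinksPoints a (m + 1)) (h' : LinksPoints b (n + 1)) :
    LinksPoints (a + b) (m + 1 + n) := by
  intro p
  obtain ⟨F, hF0, hF, hl⟩ := h (p ∘ Fin.castAdd n)
  obtain ⟨G, hG0, hG, hl'⟩ := h' (Fin.cons (p (Fin.castAdd n 0)) (p ∘ Fin.natAdd (m + 1)))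
  have hFs : zeroSet F ⊆ zeroSet (F * G) := fun x (hx : _ = _) ↦ by simp [zeroSet, hx]
  have hGs : zeroSet G ⊆ zeroSet (F * G) := fun x (hx : _ = _) ↦ by simp [zeroSet, hx]
  have key : ∀ i, Linked (zeroSet (F * G)) (p (Fin.castAdd n 0)) (p i) := by
    intro i
    refine Fin.addCases (fun i ↦ ?_) (fun i ↦ ?_) i
    · exact (hl 0 i).mono hFs
    · exact (hl' 0 i.succ).mono hGs
  exact ⟨F * G, mul_ne_zero hF0 hG0, hF.mul hG, fun i j ↦ (key i).symm.trans (key j)⟩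

lemma degree_one : LinksPoints 1 2 :=
  of_rel (by decide) fun _ hF _ hx _ hy ↦ rel_zeros_of_degree_one hF hx hy

lemma degree_two : LinksPoints 2 5 :=
  of_rel (by decide) fun _ hF _ hx _ hy ↦ rel_zeros_of_degree_two hF hx hy

lemma degree_three : LinksPoints 3 8 :=
  of_pencil (by decide) fun _ _ h₀ h₁ p hp₀ hp₁ ↦
    exists_rel_zeros_pencil_of_degree_three h₀ h₁ p hp₀ hp₁

lemma degree_four : LinksPoints 4 13 :=
  of_pencil (by decide) fun _ _ h₀ h₁ p hp₀ hp₁ ↦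
    exists_rel_zeros_pencil_of_degree_four h₀ h₁ p hp₀ hp₁

/-- In degree `q + 1`, any `3 (q + 1) - 1` points can be linked. -/
lemma three_mul_add_two : ∀ q : ℕ, LinksPoints (q + 1) (3 * q + 2)
  | 0 => degree_one
  | 1 => degree_two
  | 2 => degree_three
  | 3 => degree_four.mono (by norm_num) (by norm_num)
  | q + 4 => (three_mul_add_two q).add degree_four

end LinksPoints

/-- For every `q ≥ 1`, through any `3q - 1` points of `ℝP²` one can trace a connected component
of the real point set of a real curve of degree `q` (i.e. `c'(q) ≥ c(q) ≥ 3q - 1`). -/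
theorem stmt_9 (q : ℕ) (hq : 1 ≤ q) (p : Fin (3 * q - 1) → RP2) :
    ∃ F : MvPolynomial (Fin 3) ℝ, F ≠ 0 ∧ F.IsHomogeneous q ∧
      inOneComponent (zeroSet F) (Set.range p) := by
  obtain ⟨q, rfl⟩ := Nat.exists_eq_add_of_le' hq
  obtain ⟨F, hF0, hF, hl⟩ := LinksPoints.three_mul_add_two q p
  refine ⟨F, hF0, hF, p ⟨0, by omega⟩, (hl ⟨0, by omega⟩ ⟨0, by omega⟩).right_mem, ?_⟩
  rintro _ ⟨i, rfl⟩
  exact (hl _ i).mem_connectedComponentIn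
end
end

section
/- Let q ≥ 1 be an odd integer and set N = q(q+3)/2 − (q² − 1)/8 (note that 8 divides q² − 1 for odd q). Then there exists a set of N + 1 points in ℝP² such that for every nonzero homogeneous polynomial F ∈ ℝ[x₀,x₁,x₂] of degree q, no connected component of the real point set Z(F) contains all N + 1 points (i.e. c'(q) ≤ q(q+3)/2 − ⌊(q²−1)/8⌋ for odd q). -/
noncomputable section

open MvPolynomial

theorem aeval_smul_of_isHomogeneous {S : Type*} [CommRing S] [Algebra ℝ S]
    {F : MvPolynomial (Fin 3) ℝ} {n : ℕ} (hF : F.IsHomogeneous n) (a : S) (v : Fin 3 → S) :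
    aeval (a • v) F = a ^ n * aeval v F := by
  rw [aeval_def, aeval_def, eval₂_eq', eval₂_eq', Finset.mul_sum]
  refine Finset.sum_congr rfl fun d hd => ?_
  have hdeg : ∑ i, d i = n := by
    rw [← Finsupp.degree_eq_sum, Finsupp.degree_eq_weight_one]
    exact hF (mem_support_iff.1 hd)
  simp only [Pi.smul_apply, smul_eq_mul, mul_pow, Finset.prod_mul_distrib,
    Finset.prod_pow_eq_pow_sum, hdeg]
  ring

theorem eval_rep_mk_eq_zero_iff {F : MvPolynomial (Fin 3) ℝ} {n : ℕ} (hF : F.IsHomogeneous n)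
    (v : Fin 3 → ℝ) (hv : v ≠ 0) :
    Projectivization.mk ℝ v hv ∈ zeroSet F ↔ eval v F = 0 := by
  obtain ⟨a, ha⟩ := Projectivization.exists_smul_eq_mk_rep ℝ v hv
  have h : eval ((a : ℝ) • v) F = (a : ℝ) ^ n * eval v F := by
    simpa [aeval_eq_eval] using aeval_smul_of_isHomogeneous hF (a : ℝ) v
  rw [zeroSet, Set.mem_ofPred_eq, ← ha, Units.smul_def, h]
  simp

theorem isOpen_iff_preimage_mk (V : Set RP2) :
    IsOpen V ↔ IsOpen {w : {v : Fin 3 → ℝ // v ≠ 0} | Projectivization.mk ℝ w.1 w.2 ∈ V} :=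
  Iff.rfl

/-- The affine chart: rescale a vector so that its last coordinate is `1`. -/
def affineRep (w : Fin 3 → ℝ) : Fin 3 → ℝ := (w 2)⁻¹ • w

theorem affineRep_smul {a : ℝ} (ha : a ≠ 0) (w : Fin 3 → ℝ) :
    affineRep (a • w) = affineRep w := by
  ext i
  simp only [affineRep, Pi.smul_apply, smul_eq_mul, mul_inv]
  field_simp

theorem affineRep_apply_two {w : Fin 3 → ℝ} (h : w 2 ≠ 0) : affineRep w 2 = 1 := by
  simp [affineRep, h]

theorem affineRep_eq_self {w : Fin 3 → ℝ} (h : w 2 = 1) : affineRep w = w := by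
  simp [affineRep, h]

theorem ne_zero_of_apply_two_eq_one {v : Fin 3 → ℝ} (h : v 2 = 1) : v ≠ 0 := by
  rintro rfl
  simp at h

theorem mk_eq_mk_affineRep {w : Fin 3 → ℝ} (hw : w ≠ 0) (h : w 2 ≠ 0) :
    Projectivization.mk ℝ w hw =
      Projectivization.mk ℝ (affineRep w) (ne_zero_of_apply_two_eq_one (affineRep_apply_two h)) :=
  (Projectivization.mk_eq_mk_iff' ℝ _ _ _ _).2 ⟨w 2, by simp [affineRep, h]⟩

/-- The part of `ℝP²` whose affine representatives lie in `O`. -/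
def chartSet (O : Set (Fin 3 → ℝ)) : Set RP2 :=
  {p | p.rep 2 ≠ 0 ∧ affineRep p.rep ∈ O}

theorem mk_mem_chartSet (O : Set (Fin 3 → ℝ)) {w : Fin 3 → ℝ} (hw : w ≠ 0) :
    Projectivization.mk ℝ w hw ∈ chartSet O ↔ w 2 ≠ 0 ∧ affineRep w ∈ O := by
  obtain ⟨a, ha⟩ := Projectivization.exists_smul_eq_mk_rep ℝ w hw
  rw [chartSet, Set.mem_ofPred_eq, ← ha, Units.smul_def, affineRep_smul a.ne_zero]
  simp

theorem isOpen_chartSet {O : Set (Fin 3 → ℝ)} (hO : IsOpen O) : IsOpen (chartSet O) := by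
  rw [isOpen_iff_preimage_mk]
  simp only [mk_mem_chartSet]
  have hc : Continuous fun w : {v : Fin 3 → ℝ // v ≠ 0} => w.1 2 :=
    (continuous_apply 2).comp continuous_subtype_val
  have hU : IsOpen {w : {v : Fin 3 → ℝ // v ≠ 0} | w.1 2 ≠ 0} := isOpen_ne_fun hc continuous_const
  refine ContinuousOn.isOpen_inter_preimage (f := fun w : {v : Fin 3 → ℝ // v ≠ 0} =>
    affineRep w.1) ?_ hU hO
  unfold affineRep
  exact (hc.continuousOn.inv₀ fun w hw => hw).smul continuous_subtype_val.continuousOn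

theorem isOpen_ne_mk {v : Fin 3 → ℝ} (h : v 2 = 1) :
    IsOpen {p : RP2 | p ≠ Projectivization.mk ℝ v (ne_zero_of_apply_two_eq_one h)} := by
  rw [isOpen_iff_preimage_mk]
  have : {w : {v : Fin 3 → ℝ // v ≠ 0} | Projectivization.mk ℝ w.1 w.2 ∈
      {p : RP2 | p ≠ Projectivization.mk ℝ v (ne_zero_of_apply_two_eq_one h)}} =
      {w | w.1 ≠ w.1 2 • v} := by
    ext w
    simp only [Set.mem_ofPred_eq, ne_eq, Projectivization.mk_eq_mk_iff', not_iff_not]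
    constructor
    · rintro ⟨a, ha⟩
      have : w.1 2 = a := by rw [← ha]; simp [h]
      rw [this, ha]
    · intro hw
      exact ⟨_, hw.symm⟩
  rw [this]
  exact isOpen_ne_fun continuous_subtype_val
    (((continuous_apply 2).comp continuous_subtype_val).smul continuous_const)

/-- A set containing an isolated point of `Z` and some other point does not lie in one component
of `Z`. -/
theorem not_inOneComponent_of_isolated {Z S : Set RP2} {v : Fin 3 → ℝ} (h : v 2 = 1)
    {V : Set RP2} (hV : IsOpen V)
    (hiso : ∀ p ∈ Z ∩ V, p = Projectivization.mk ℝ v (ne_zero_of_apply_two_eq_one h))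
    (hvV : Projectivization.mk ℝ v (ne_zero_of_apply_two_eq_one h) ∈ V)
    (hvS : Projectivization.mk ℝ v (ne_zero_of_apply_two_eq_one h) ∈ S)
    (hne : ∃ p ∈ S, p ≠ Projectivization.mk ℝ v (ne_zero_of_apply_two_eq_one h)) :
    ¬ inOneComponent Z S := by
  rintro ⟨p₀, hp₀, hS⟩
  obtain ⟨p, hpS, hp⟩ := hne
  obtain ⟨x, hxC, hxV, hx⟩ := (isPreconnected_connectedComponentIn (x := p₀) (F := Z)) V _ hV
    (isOpen_ne_mk h) (fun y _ => by
      by_cases hy : y = Projectivization.mk ℝ v (ne_zero_of_apply_two_eq_one h)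
      · exact Or.inl (hy ▸ hvV)
      · exact Or.inr hy) ⟨_, hS hvS, hvV⟩ ⟨p, hS hpS, hp⟩
  exact hx (hiso x ⟨connectedComponentIn_subset _ _ hxC, hxV⟩)

/-- Evaluation at `v` as a linear functional on forms of degree `n`. -/
def evalForm (n : ℕ) (v : Fin 3 → ℝ) : Module.Dual ℝ (homogeneousSubmodule (Fin 3) ℝ n) :=
  (aeval v).toLinearMap ∘ₗ (homogeneousSubmodule (Fin 3) ℝ n).subtype

theorem evalForm_apply (n : ℕ) (v : Fin 3 → ℝ) (F : homogeneousSubmodule (Fin 3) ℝ n) :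
    evalForm n v F = eval v F.1 := by
  simp [evalForm, aeval_eq_eval]

instance finite_homogeneousSubmodule (n : ℕ) :
    Module.Finite ℝ (homogeneousSubmodule (Fin 3) ℝ n) :=
  Module.Finite.iff_fg.2 (homogeneousSubmodule_fg _ _ n)

theorem finrank_homogeneousSubmodule (n : ℕ) :
    Module.finrank ℝ (homogeneousSubmodule (Fin 3) ℝ n) = (n + 2).choose 2 := by
  rw [homogeneousSubmodule_eq_finsupp_supported]
  rw [(AddMonoidAlgebra.supportedEquivFinsupp (R := ℝ) (S := ℝ)
    {d : Fin 3 →₀ ℕ | d.degree = n}).finrank_eq]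
  have hset : {d : Fin 3 →₀ ℕ | d.degree = n} =
      ((Finset.univ : Finset (Fin 3)).finsuppAntidiag n : Set (Fin 3 →₀ ℕ)) := by
    ext d
    simp [Finset.mem_finsuppAntidiag, Finsupp.degree_eq_sum]
  rw [hset, Module.finrank_finsupp_self]
  simp only [Fintype.card_coe, SetLike.coe_sort_coe, Finset.card_finsuppAntidiag_nat_eq_choose,
    Finset.card_univ, Fintype.card_fin]
  rw [show 3 + n - 1 = n + 2 by omega]
  exact Nat.choose_symm_add

/-- Finitely many points of `A`, including a prescribed independent set `B`, already detect
vanishing on `A` of forms of degree `n`. -/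
theorem exists_points_detecting (n : ℕ) {A B : Set (Fin 3 → ℝ)} (hA : ∀ v ∈ A, v ≠ 0)
    (hBA : B ⊆ A) (hB : LinearIndepOn ℝ (evalForm n) B) (K : ℕ)
    (hK : Module.finrank ℝ (Submodule.span ℝ (evalForm n '' A)) ≤ K) :
    ∃ p : Fin K → RP2, (∀ v ∈ B, ∃ hv : v ≠ 0, Projectivization.mk ℝ v hv ∈ Set.range p) ∧
      ∀ F : MvPolynomial (Fin 3) ℝ, F.IsHomogeneous n → (∀ i, p i ∈ zeroSet F) →
        ∀ v ∈ A, eval v F = 0 := by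
  obtain ⟨b, hbA, hBb, hspan, hb⟩ := exists_linearIndepOn_extension hB hBA
  have : Finite b := hb.linearIndependent.finite
  have := Fintype.ofFinite b
  have hcard : Fintype.card b ≤ K := by
    refine le_trans ?_ hK
    rw [← finrank_span_eq_card hb.linearIndependent]
    refine Submodule.finrank_mono (Submodule.span_mono ?_)
    rintro _ ⟨x, rfl⟩
    exact ⟨x, hbA x.2, rfl⟩
  obtain ⟨e⟩ : Nonempty (b ↪ Fin K) :=
    Function.Embedding.nonempty_of_card_le (by simpa using hcard)
  let f : b → RP2 := fun x => Projectivization.mk ℝ x.1 (hA _ (hbA x.2))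
  have hf (x : b) : Function.extend e f (fun _ => Projectivization.mk ℝ 1 one_ne_zero) (e x) = f x :=
    e.injective.extend_apply _ _ _
  refine ⟨Function.extend e f fun _ => Projectivization.mk ℝ 1 one_ne_zero, ?_, ?_⟩
  · intro v hv
    exact ⟨hA v (hBA hv), e ⟨v, hBb hv⟩, hf _⟩
  · intro F hF hp v hv
    have hle : Submodule.span ℝ (evalForm n '' b) ≤
        LinearMap.ker (Module.Dual.eval ℝ _ (⟨F, hF⟩ : homogeneousSubmodule (Fin 3) ℝ n)) := by
      rw [Submodule.span_le]
      rintro _ ⟨x, hx, rfl⟩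
      have h1 := hp (e ⟨x, hx⟩)
      rw [hf, eval_rep_mk_eq_zero_iff hF] at h1
      simpa [evalForm_apply] using h1
    simpa [evalForm_apply] using hle (hspan ⟨v, hv, rfl⟩)

/-- The parametrization `t ↦ ((t - 1) ^ d : t ^ d : 1)` of a rational curve of degree `d`. -/
def paramPoly (d : ℕ) : Fin 3 → Polynomial ℝ :=
  ![(Polynomial.X - 1) ^ d, Polynomial.X ^ d, 1]

/-- The real affine points `((t - 1) ^ d, t ^ d, 1)` for complex parameters `t`. -/
def curvePoints (d : ℕ) : Set (Fin 3 → ℝ) :=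
  {v | v 2 = 1 ∧ ∃ t : ℂ, (t - 1) ^ d = v 0 ∧ t ^ d = v 1}

/-- The solitary points of the curve: those coming from a non-real parameter. -/
def solitaryPoints (d : ℕ) : Set (Fin 3 → ℝ) :=
  {v | v 2 = 1 ∧ ∃ t : ℂ, t.im ≠ 0 ∧ (t - 1) ^ d = v 0 ∧ t ^ d = v 1}

theorem solitaryPoints_subset (d : ℕ) : solitaryPoints d ⊆ curvePoints d :=
  fun _ ⟨h, t, _, ht⟩ => ⟨h, t, ht⟩

theorem ofReal_eval_eq_aeval_param (d : ℕ) (F : MvPolynomial (Fin 3) ℝ) {v : Fin 3 → ℝ} {t : ℂ}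
    (h2 : v 2 = 1) (h0 : (t - 1) ^ d = v 0) (h1 : t ^ d = v 1) :
    ((eval v F : ℝ) : ℂ) = Polynomial.aeval t (aeval (paramPoly d) F) := by
  have e1 : ((eval v F : ℝ) : ℂ) = aeval (fun i => (v i : ℂ)) F := by
    have := aeval_algebraMap_apply ℂ v F
    simpa [aeval_eq_eval, Function.comp_def] using this.symm
  rw [e1, ← AlgHom.comp_apply, comp_aeval]
  congr 2
  ext i
  fin_cases i <;> simp [paramPoly, h0, h1, h2]

theorem aeval_param_eq_zero_of_forall {d : ℕ} {F : MvPolynomial (Fin 3) ℝ}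
    (h : ∀ v ∈ curvePoints d, eval v F = 0) : aeval (paramPoly d) F = 0 := by
  refine Polynomial.funext fun t => ?_
  have hv := h ![(t - 1) ^ d, t ^ d, 1] ⟨rfl, t, by simp, by simp⟩
  have := ofReal_eval_eq_aeval_param d F (v := ![(t - 1) ^ d, t ^ d, 1]) (t := t) rfl
    (by simp) (by simp)
  rw [hv] at this
  have h2 := Polynomial.aeval_algebraMap_apply ℂ t (aeval (paramPoly d) F)
  simp only [Complex.coe_algebraMap] at h2
  rw [h2] at this
  simpa [Polynomial.aeval_def] using this.symm

theorem exists_rootsOfUnity_finset {d : ℕ} (hd : 0 < d) :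
    ∃ s : Finset ℂ, s.card = d ∧ ∀ z, z ∈ s ↔ z ^ d = 1 := by
  refine ⟨Polynomial.nthRootsFinset d (1 : ℂ),
    (Complex.isPrimitiveRoot_exp d hd.ne').card_nthRootsFinset, fun z => ?_⟩
  rw [Polynomial.mem_nthRootsFinset hd]

/-- A form of degree less than `d` in the first variable vanishing on the parametrized curve is
zero. -/
theorem eq_zero_of_aeval_param_eq_zero {d n : ℕ} {F : MvPolynomial (Fin 3) ℝ}
    (hF : F.IsHomogeneous n) (hdeg : F.degreeOf 0 < d) (h : aeval (paramPoly d) F = 0) :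
    F = 0 := by
  obtain ⟨s, hs, hmem⟩ := exists_rootsOfUnity_finset (d := d) (by omega)
  let ψ : MvPolynomial (Fin 2) ℝ →ₐ[ℝ] Polynomial ℂ := aeval ![Polynomial.X ^ d, 1]
  let G : Polynomial (Polynomial ℂ) := (finSuccEquiv ℝ 2 F).map ψ.toRingHom
  have hGeval (y : Polynomial ℂ) : G.eval y = aeval ![y, Polynomial.X ^ d, 1] F := by
    suffices hL : (Polynomial.eval₂RingHom ψ.toRingHom y).comp
        (finSuccEquiv ℝ 2 : MvPolynomial (Fin 3) ℝ →+* _) =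
        (aeval ![y, Polynomial.X ^ d, 1] : MvPolynomial (Fin 3) ℝ →ₐ[ℝ] Polynomial ℂ) by
      simpa [G, Polynomial.eval_map] using DFunLike.congr_fun hL F
    refine MvPolynomial.ringHom_ext (fun r => ?_) fun i => ?_
    · have := DFunLike.congr_fun (finSuccEquiv_comp_C_eq_C (R := ℝ) 2) r
      simp only [RingHom.comp_apply, RingHom.coe_coe] at this
      replace this := (AlgEquiv.symm_apply_eq (finSuccEquiv ℝ 2)).1 this
      simp [← this, ψ]
    · fin_cases i
      · simp [finSuccEquiv_X_zero]
      · have := finSuccEquiv_X_succ (R := ℝ) (n := 2) (j := 0)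
        simp only [Fin.succ_zero_eq_one] at this
        simp [this, ψ]
      · have := finSuccEquiv_X_succ (R := ℝ) (n := 2) (j := 1)
        simp only [Fin.succ_one_eq_two] at this
        simp [this, ψ]
  have hG0 : G = 0 := by
    refine Polynomial.eq_zero_of_natDegree_lt_card_of_eval_eq_zero' G
      (s.image fun ζ => (Polynomial.C ζ * Polynomial.X - 1) ^ d) ?_ ?_
    · simp only [Finset.mem_image]
      rintro _ ⟨ζ, hζ, rfl⟩
      rw [hGeval]
      let c : Polynomial ℝ →ₐ[ℝ] Polynomial ℂ :=
        Polynomial.aeval (Polynomial.C ζ * Polynomial.X)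
      have hc := congrArg c h
      rw [map_zero, ← AlgHom.comp_apply, comp_aeval] at hc
      rw [← hc]
      congr 2
      ext i : 1
      fin_cases i
      · simp [c, paramPoly]
      · simp [c, paramPoly, mul_pow, ← Polynomial.C_pow, (hmem ζ).1 hζ]
      · simp [c, paramPoly]
    · rw [Finset.card_image_of_injective, hs]
      · refine lt_of_le_of_lt Polynomial.natDegree_map_le ?_
        rwa [natDegree_finSuccEquiv]
      · intro ζ ξ hζξ
        have := congrArg (fun p => (Polynomial.derivative p).eval 0) hζξ
        simpa [Polynomial.derivative_pow, show d ≠ 0 by omega] using this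
  have haff (y x : ℝ) : eval ![y, x, 1] F = 0 := by
    obtain ⟨r, hr⟩ := IsAlgClosed.exists_pow_nat_eq (x : ℂ) (show 0 < d by omega)
    have h1 := hGeval (Polynomial.C (y : ℂ))
    rw [hG0, Polynomial.eval_zero] at h1
    have h3 := congrArg ((Polynomial.aeval r : Polynomial ℂ →ₐ[ℂ] ℂ).restrictScalars ℝ) h1
    rw [map_zero, ← AlgHom.comp_apply, comp_aeval] at h3
    have e1 := aeval_algebraMap_apply ℂ ![y, x, 1] F
    have e2 : (algebraMap ℝ ℂ ∘ ![y, x, 1]) = fun i =>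
        ((Polynomial.aeval r : Polynomial ℂ →ₐ[ℂ] ℂ).restrictScalars ℝ)
          ((![Polynomial.C (y : ℂ), Polynomial.X ^ d, 1] : Fin 3 → Polynomial ℂ) i) := by
      ext i
      fin_cases i <;> simp [hr]
    rw [e2, ← h3] at e1
    simpa [aeval_eq_eval] using e1.symm
  have hX : X 2 * F = 0 := by
    refine MvPolynomial.funext fun v => ?_
    by_cases hv : v 2 = 0
    · simp [hv]
    · have := aeval_smul_of_isHomogeneous hF (v 2) ![v 0 / v 2, v 1 / v 2, 1]
      have e : v 2 • ![v 0 / v 2, v 1 / v 2, 1] = v := by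
        ext i
        fin_cases i <;> simp <;> field_simp
      rw [e] at this
      simp only [aeval_eq_eval] at this
      simp [this, haff]
  exact (mul_eq_zero.1 hX).resolve_left (X_ne_zero 2)

open ComplexConjugate in
/-- A complex number whose `d`-th power is real is its conjugate up to a `d`-th root of unity. -/
theorem div_conj_pow_eq_one {d : ℕ} {t : ℂ} (ht : t ≠ 0) (h : conj (t ^ d) = t ^ d) :
    (t / conj t) ^ d = 1 := by
  rw [div_pow, ← map_pow, h, div_self (pow_ne_zero _ ht)]

/-- The non-real parameters of the solitary points are parametrized by pairs of roots of unity. -/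
def solitaryParam (z : ℂ × ℂ) : ℂ := z.1 * (1 - z.2) / (z.1 - z.2)

open ComplexConjugate in
theorem conj_eq_inv_of_pow_eq_one {d : ℕ} (hd : 0 < d) {ζ : ℂ} (h : ζ ^ d = 1) :
    conj ζ = ζ⁻¹ :=
  (Complex.inv_eq_conj (Complex.norm_eq_one_of_pow_eq_one h hd.ne')).symm

open ComplexConjugate in
theorem mul_conj_solitaryParam {d : ℕ} (hd : 0 < d) {ζ ξ : ℂ} (hζ : ζ ^ d = 1) (hξ : ξ ^ d = 1)
    (hne : ζ ≠ ξ) :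
    ζ * conj (solitaryParam (ζ, ξ)) = solitaryParam (ζ, ξ) ∧
      ξ * (conj (solitaryParam (ζ, ξ)) - 1) = solitaryParam (ζ, ξ) - 1 := by
  have h1 : ζ ≠ 0 := by rintro rfl; simp [hd.ne'] at hζ
  have h2 : ξ ≠ 0 := by rintro rfl; simp [hd.ne'] at hξ
  have h3 : ζ - ξ ≠ 0 := sub_ne_zero.2 hne
  have h4 : ξ - ζ ≠ 0 := sub_ne_zero.2 hne.symm
  have h5 : ζ⁻¹ - ξ⁻¹ = (ξ - ζ) / (ζ * ξ) := by field_simp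
  simp only [solitaryParam, map_div₀, map_mul, map_sub, map_one, conj_eq_inv_of_pow_eq_one hd hζ,
    conj_eq_inv_of_pow_eq_one hd hξ, h5]
  constructor
  · field_simp
    ring
  · field_simp
    ring

open ComplexConjugate in
theorem eq_solitaryParam {t ζ ξ : ℂ} (ht : t.im ≠ 0) (h0 : t = ζ * conj t)
    (h1 : t - 1 = ξ * conj (t - 1)) : ζ ≠ ξ ∧ t = solitaryParam (ζ, ξ) := by
  have hlin : t * (ζ - ξ) = ζ * (1 - ξ) := by
    rw [map_sub, map_one] at h1
    linear_combination ζ * h1 - ξ * h0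
  have hne : ζ ≠ ξ := by
    rintro rfl
    have hζ0 : ζ ≠ 0 := by
      rintro rfl
      rw [zero_mul] at h0
      simp [h0] at ht
    have : ζ = 1 := by
      have : ζ * (1 - ζ) = 0 := by rw [← hlin]; ring
      rcases mul_eq_zero.1 this with h | h
      · exact absurd h hζ0
      · exact (sub_eq_zero.1 h).symm
    rw [this, one_mul] at h0
    exact ht (Complex.conj_eq_iff_im.1 h0.symm)
  refine ⟨hne, ?_⟩
  rw [solitaryParam, eq_div_iff (sub_ne_zero.2 hne), hlin]

open ComplexConjugate in
theorem finite_solitaryPoints {d : ℕ} (hd : 0 < d) : (solitaryPoints d).Finite := by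
  obtain ⟨s, -, hmem⟩ := exists_rootsOfUnity_finset hd
  refine (((s ×ˢ s).image fun z =>
    ![((solitaryParam z - 1) ^ d).re, (solitaryParam z ^ d).re, 1]).finite_toSet).subset ?_
  rintro v ⟨h2, t, ht, h0, h1⟩
  have ht0 : t ≠ 0 := by rintro rfl; simp at ht
  have ht1 : t - 1 ≠ 0 := fun h => ht (by rw [sub_eq_zero.1 h]; simp)
  have hc0 : conj t ≠ 0 := by simpa using ht0
  have hc1 : conj (t - 1) ≠ 0 := by rwa [ne_eq, map_eq_zero]
  have e := (eq_solitaryParam (ζ := t / conj t) (ξ := (t - 1) / conj (t - 1)) ht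
    (by field_simp) (by field_simp)).2
  simp only [Finset.coe_image, Set.mem_image, Finset.mem_coe]
  refine ⟨(t / conj t, (t - 1) / conj (t - 1)), ?_, ?_⟩
  · rw [Finset.mem_product, hmem, hmem]
    exact ⟨div_conj_pow_eq_one ht0 (by rw [h1, Complex.conj_ofReal]),
      div_conj_pow_eq_one ht1 (by rw [h0, Complex.conj_ofReal])⟩
  · rw [← e]
    ext i
    fin_cases i <;> simp [h0, h1, h2]

open ComplexConjugate in
/-- There are at least `(d - 1) * (d - 2)` non-real parameters of solitary points. -/
theorem exists_solitary_params {d : ℕ} (hd : 0 < d) :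
    ∃ T : Finset ℂ, T.card = (d - 1) * (d - 1) - (d - 1) ∧
      ∀ t ∈ T, t.im ≠ 0 ∧ conj ((t - 1) ^ d) = (t - 1) ^ d ∧ conj (t ^ d) = t ^ d := by
  obtain ⟨s, hs, hmem⟩ := exists_rootsOfUnity_finset hd
  have hspec : ∀ z ∈ (s.erase 1).offDiag, z.1 ≠ 1 ∧ z.2 ≠ 1 ∧ z.1 ^ d = 1 ∧ z.2 ^ d = 1 ∧
      z.1 ≠ z.2 := by
    intro z hz
    simp only [Finset.mem_offDiag, Finset.mem_erase, hmem] at hz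
    exact ⟨hz.1.1, hz.2.1.1, hz.1.2, hz.2.1.2, hz.2.2⟩
  have hne0 : ∀ z ∈ (s.erase 1).offDiag, solitaryParam z ≠ 0 := by
    intro z hz
    obtain ⟨h1, h2, h3, h4, h5⟩ := hspec z hz
    have h6 : z.1 ≠ 0 := by intro h; simp [h, hd.ne'] at h3
    exact div_ne_zero (mul_ne_zero h6 (sub_ne_zero.2 h2.symm)) (sub_ne_zero.2 h5)
  have him : ∀ z ∈ (s.erase 1).offDiag, (solitaryParam z).im ≠ 0 := by
    intro z hz h
    obtain ⟨h1, h2, h3, h4, h5⟩ := hspec z hz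
    have h6 := (mul_conj_solitaryParam hd h3 h4 h5).1
    rw [Complex.conj_eq_iff_im.2 h] at h6
    exact h1 (mul_right_cancel₀ (hne0 z hz) (by rw [one_mul]; exact h6))
  refine ⟨(s.erase 1).offDiag.image solitaryParam, ?_, ?_⟩
  · rw [Finset.card_image_of_injOn, Finset.offDiag_card, Finset.card_erase_of_mem, hs]
    · rw [hmem, one_pow]
    · intro z hz w hw hzw
      obtain ⟨-, -, h3, h4, h5⟩ := hspec z hz
      obtain ⟨-, -, k3, k4, k5⟩ := hspec w hw
      obtain ⟨a1, a2⟩ := mul_conj_solitaryParam hd h3 h4 h5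
      obtain ⟨b1, b2⟩ := mul_conj_solitaryParam hd k3 k4 k5
      simp only [Prod.mk.eta] at a1 a2 b1 b2
      rw [← hzw] at b1 b2
      have hc0 : conj (solitaryParam z) ≠ 0 := by simpa using hne0 z hz
      have hc1 : conj (solitaryParam z) - 1 ≠ 0 := by
        intro h
        have := congrArg Complex.im h
        simp only [Complex.sub_im, Complex.conj_im, Complex.one_im, Complex.zero_im] at this
        exact him z hz (by linarith)
      exact Prod.ext (mul_right_cancel₀ hc0 (a1.trans b1.symm))
        (mul_right_cancel₀ hc1 (a2.trans b2.symm))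
  · simp only [Finset.mem_image]
    rintro _ ⟨z, hz, rfl⟩
    obtain ⟨h1, h2, h3, h4, h5⟩ := hspec z hz
    obtain ⟨a1, a2⟩ := mul_conj_solitaryParam hd h3 h4 h5
    simp only [Prod.mk.eta] at a1 a2
    refine ⟨him z hz, ?_, ?_⟩
    · rw [map_pow, map_sub, map_one]
      conv_rhs => rw [← a2, mul_pow, h4, one_mul]
    · rw [map_pow]
      conv_rhs => rw [← a1, mul_pow, h3, one_mul]

/-- A form of degree `m` vanishing at the solitary points of the curve of degree `m + 3` is
zero. -/
theorem eq_zero_of_vanish_solitaryPoints {m : ℕ} {R : MvPolynomial (Fin 3) ℝ}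
    (hR : R.IsHomogeneous m) (h : ∀ v ∈ solitaryPoints (m + 3), eval v R = 0) : R = 0 := by
  refine eq_zero_of_aeval_param_eq_zero (d := m + 3) hR ?_ ?_
  · have h1 := degreeOf_le_totalDegree R 0
    have h2 := hR.totalDegree_le
    omega
  obtain ⟨T, hT, hTspec⟩ := exists_solitary_params (d := m + 3) (by omega)
  let r := aeval (paramPoly (m + 3)) R
  have hdeg : r.natDegree ≤ m * (m + 3) := by
    refine aeval_natDegree_le R hR.totalDegree_le _ fun i => ?_
    fin_cases i
    · have := Polynomial.natDegree_pow_le_of_le (m + 3) (Polynomial.natDegree_X_sub_C_le (1 : ℝ))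
      rw [mul_one, Polynomial.C_1] at this
      exact this
    · simp [paramPoly]
    · simp [paramPoly]
  have hmap : r.map (algebraMap ℝ ℂ) = 0 := by
    refine Polynomial.eq_zero_of_natDegree_lt_card_of_eval_eq_zero' _ T (fun t ht => ?_) ?_
    · obtain ⟨him, h0, h1⟩ := hTspec t ht
      rw [Complex.conj_eq_iff_re] at h0 h1
      have hv := ofReal_eval_eq_aeval_param (m + 3) R
        (v := ![((t - 1) ^ (m + 3)).re, (t ^ (m + 3)).re, 1]) rfl h0.symm h1.symm
      rw [h _ ⟨rfl, t, him, h0.symm, h1.symm⟩] at hv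
      rw [Polynomial.eval_map_algebraMap, ← hv, Complex.ofReal_zero]
    · refine lt_of_le_of_lt (Polynomial.natDegree_map_le.trans hdeg) ?_
      rw [hT, show m + 3 - 1 = m + 2 by omega, Nat.lt_sub_iff_add_lt]
      ring_nf
      omega
  exact (Polynomial.map_eq_zero _).1 hmap

/-- Solitary points are isolated among the points of the curve. -/
theorem exists_isOpen_inter_curvePoints {d : ℕ} (hd : 0 < d) {v : Fin 3 → ℝ}
    (hv : v ∈ solitaryPoints d) :
    ∃ O : Set (Fin 3 → ℝ), IsOpen O ∧ v ∈ O ∧ ∀ w ∈ O, w ∈ curvePoints d → w = v := by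
  let a : (Fin 3 → ℝ) → ℝ := fun w => |w 1| ^ ((d : ℝ)⁻¹)
  let b : (Fin 3 → ℝ) → ℝ := fun w => |w 0| ^ ((d : ℝ)⁻¹)
  have hca : Continuous a :=
    ((continuous_apply 1).abs).rpow_const fun _ => Or.inr (by positivity)
  have hcb : Continuous b :=
    ((continuous_apply 0).abs).rpow_const fun _ => Or.inr (by positivity)
  have hab {w : Fin 3 → ℝ} {t : ℂ} (h0 : (t - 1) ^ d = w 0) (h1 : t ^ d = w 1) :
      a w = ‖t‖ ∧ b w = ‖t - 1‖ := by
    constructor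
    · have : |w 1| = ‖t‖ ^ d := by rw [← norm_pow, h1, Complex.norm_real, Real.norm_eq_abs]
      simp only [a, this]
      exact Real.pow_rpow_inv_natCast (norm_nonneg _) hd.ne'
    · have : |w 0| = ‖t - 1‖ ^ d := by
        rw [← norm_pow, h0, Complex.norm_real, Real.norm_eq_abs]
      simp only [b, this]
      exact Real.pow_rpow_inv_natCast (norm_nonneg _) hd.ne'
  let U : Set (Fin 3 → ℝ) := {w | 1 < a w + b w} ∩ ({w | a w < 1 + b w} ∩ {w | b w < 1 + a w})
  have hU : IsOpen U := (isOpen_lt continuous_const (hca.add hcb)).inter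
    ((isOpen_lt hca (continuous_const.add hcb)).inter (isOpen_lt hcb (continuous_const.add hca)))
  refine ⟨U \ (solitaryPoints d \ {v}), hU.sdiff
    ((finite_solitaryPoints hd).subset Set.sdiff_subset).isClosed, ⟨?_, by simp⟩, ?_⟩
  · obtain ⟨-, t, him, h0, h1⟩ := hv
    obtain ⟨ha, hb⟩ := hab h0 h1
    have h3 : |t.re| < ‖t‖ := Complex.abs_re_lt_norm.2 him
    have h4 : |t.re - 1| < ‖t - 1‖ := by
      simpa using (Complex.abs_re_lt_norm (z := t - 1)).2 (by simpa using him)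
    have hsq : ‖t - 1‖ ^ 2 = ‖t‖ ^ 2 - 2 * t.re + 1 := by
      rw [Complex.sq_norm, Complex.sq_norm, Complex.normSq_apply, Complex.normSq_apply]
      simp
      ring
    simp only [U, Set.mem_inter_iff, Set.mem_ofPred_eq, ha, hb]
    rw [abs_lt] at h3 h4
    refine ⟨by linarith, ?_, ?_⟩
    · refine lt_of_pow_lt_pow_left₀ 2 (by positivity) ?_
      nlinarith
    · refine lt_of_pow_lt_pow_left₀ 2 (by positivity) ?_
      nlinarith
  · rintro w ⟨hwU, hwn⟩ ⟨h2, t, h0, h1⟩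
    by_contra hne
    by_cases him : t.im = 0
    · obtain ⟨ha, hb⟩ := hab h0 h1
      have ht : t = (t.re : ℂ) := Complex.ext rfl (by simpa using him)
      rw [ht] at ha hb
      rw [Complex.norm_real, Real.norm_eq_abs] at ha
      rw [← Complex.ofReal_one, ← Complex.ofReal_sub, Complex.norm_real, Real.norm_eq_abs] at hb
      simp only [U, Set.mem_inter_iff, Set.mem_ofPred_eq, ha, hb] at hwU
      obtain ⟨u1, u2, u3⟩ := hwU
      rcases abs_cases t.re with ⟨e1, _⟩ | ⟨e1, _⟩ <;>
        rcases abs_cases (t.re - 1) with ⟨e2, _⟩ | ⟨e2, _⟩ <;>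
        rw [e1, e2] at u1 u2 u3 <;> linarith
    · exact hwn ⟨⟨h2, t, him, h0, h1⟩, hne⟩

section CurvePoly

variable {S : Type*} [CommRing S]

/-- The matrix of the `k`-th power of the cyclic shift `T` with `T ^ d = x` for `z = 1`. -/
def shiftMatrix (d : ℕ) (x z : S) (k : ℕ) : Matrix (Fin d) (Fin d) S :=
  Matrix.of fun i j => if i.1 = j.1 + k then z else if i.1 + d = j.1 + k then x else 0

/-- A matrix of linear forms in `x` and `z` which for `z = 1` is `(T - 1) ^ d`, where `T` is the
cyclic shift with `T ^ d = x`. -/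
def pencilMatrix (d : ℕ) (x z : S) : Matrix (Fin d) (Fin d) S :=
  ∑ k ∈ Finset.range (d + 1), ((-1) ^ (d - k) * (d.choose k : S)) • shiftMatrix d x z k

/-- The equation of the rational curve parametrized by `((t - 1) ^ d : t ^ d : 1)`. -/
def curvePoly (d : ℕ) : MvPolynomial (Fin 3) ℝ :=
  Matrix.det (Matrix.scalar (Fin d) (X 0) - pencilMatrix d (X 1) (X 2))

theorem pencilMatrix_map {S' : Type*} [CommRing S'] (f : S →+* S') (d : ℕ) (x z : S) :
    f.mapMatrix (pencilMatrix d x z) = pencilMatrix d (f x) (f z) := by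
  ext i j
  simp only [pencilMatrix, shiftMatrix, RingHom.mapMatrix_apply, Matrix.map_apply,
    Matrix.sum_apply, Matrix.smul_apply, Matrix.of_apply, smul_eq_mul, map_sum, map_mul, map_pow,
    map_neg, map_one, map_natCast, apply_ite f, map_zero]

theorem map_det_scalar_sub_pencilMatrix {S' : Type*} [CommRing S'] (f : S →+* S') (d : ℕ)
    (y x z : S) :
    f (Matrix.scalar (Fin d) y - pencilMatrix d x z).det =
      (Matrix.scalar (Fin d) (f y) - pencilMatrix d (f x) (f z)).det := by
  rw [RingHom.map_det, map_sub, pencilMatrix_map]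
  congr 2
  ext i j
  simp [Matrix.scalar_apply, Matrix.diagonal_apply, apply_ite f]

theorem shiftMatrix_one_mulVec {d : ℕ} (hd : 0 < d) (x : S) (w : Fin d → S) (i : Fin d) :
    (shiftMatrix d x 1 1).mulVec w i =
      if _h : i.1 = 0 then x * w ⟨d - 1, by omega⟩ else w ⟨i.1 - 1, by omega⟩ := by
  rw [Matrix.mulVec, dotProduct]
  split_ifs with h
  · rw [Finset.sum_eq_single ⟨d - 1, by omega⟩]
    · have h1 : ¬ i.1 = d - 1 + 1 := by omega
      have h2 : i.1 + d = d - 1 + 1 := by omega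
      simp only [shiftMatrix, Matrix.of_apply, if_neg h1, if_pos h2]
    · intro j _ hj
      have h1 : ¬ i.1 = j.1 + 1 := by omega
      have h2 : ¬ i.1 + d = j.1 + 1 := fun h' => hj (Fin.ext (by simp only; omega))
      simp only [shiftMatrix, Matrix.of_apply, if_neg h1, if_neg h2, zero_mul]
    · simp
  · rw [Finset.sum_eq_single ⟨i.1 - 1, by omega⟩]
    · have h1 : i.1 = i.1 - 1 + 1 := by omega
      simp only [shiftMatrix, Matrix.of_apply, if_pos h1, one_mul]
    · intro j _ hj
      have h1 : ¬ i.1 = j.1 + 1 := fun h' => hj (Fin.ext (by simp only; omega))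
      have h2 : ¬ i.1 + d = j.1 + 1 := by omega
      simp only [shiftMatrix, Matrix.of_apply, if_neg h1, if_neg h2, zero_mul]
    · simp

theorem shiftMatrix_one_pow {d : ℕ} (hd : 0 < d) (x : S) (k : ℕ) (hk : k ≤ d) :
    shiftMatrix d x 1 1 ^ k = shiftMatrix d x 1 k := by
  induction k with
  | zero =>
    ext i j
    have h2 : ¬ i.1 + d = j.1 := by omega
    simp [shiftMatrix, Matrix.one_apply, h2, Fin.ext_iff]
  | succ k ih =>
    rw [pow_succ', ih (by omega)]
    ext i j
    have := shiftMatrix_one_mulVec hd x (fun l => shiftMatrix d x 1 k l j) i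
    rw [Matrix.mulVec, dotProduct] at this
    rw [Matrix.mul_apply, this]
    simp only [shiftMatrix, Matrix.of_apply]
    split_ifs <;> first | omega | simp

theorem pencilMatrix_eq_pow {d : ℕ} (hd : 0 < d) (x : S) :
    pencilMatrix d x 1 = (shiftMatrix d x 1 1 - 1) ^ d := by
  rw [sub_eq_add_neg, (Commute.one_right _).neg_right.add_pow, pencilMatrix]
  refine Finset.sum_congr rfl fun k hk => ?_
  rw [← shiftMatrix_one_pow hd x k (by simpa [Nat.lt_succ_iff] using hk), Algebra.smul_def,
    mul_assoc, Algebra.commutes]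
  simp [map_mul, map_pow]

theorem mem_spectrum_pencilMatrix {d : ℕ} (hd : 0 < d) (x y : ℂ) :
    y ∈ spectrum ℂ (pencilMatrix d x 1) ↔ ∃ t : ℂ, (t - 1) ^ d = y ∧ t ^ d = x := by
  have : Nonempty (Fin d) := ⟨⟨0, hd⟩⟩
  have hdeg : 0 < ((Polynomial.X - 1 : Polynomial ℂ) ^ d).degree := by
    rw [← Polynomial.C_1, Polynomial.degree_pow, Polynomial.degree_X_sub_C]
    simpa using hd
  have hp : spectrum ℂ (pencilMatrix d x 1) =
      (fun t => (t - 1) ^ d) '' spectrum ℂ (shiftMatrix d x 1 1) := by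
    have := spectrum.map_polynomial_aeval_of_degree_pos (shiftMatrix d x 1 1)
      ((Polynomial.X - 1 : Polynomial ℂ) ^ d) hdeg
    simpa [pencilMatrix_eq_pow hd] using this
  have hpow : shiftMatrix d x 1 1 ^ d = algebraMap ℂ (Matrix (Fin d) (Fin d) ℂ) x := by
    rw [shiftMatrix_one_pow hd x d le_rfl]
    ext i j
    have h1 : ¬ i.1 = j.1 + d := by omega
    simp [shiftMatrix, Matrix.algebraMap_matrix_apply, h1, Fin.ext_iff]
  rw [hp]
  constructor
  · rintro ⟨t, ht, rfl⟩
    refine ⟨t, rfl, ?_⟩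
    have h1 := spectrum.map_pow_of_pos (𝕜 := ℂ) (shiftMatrix d x 1 1) hd
    rw [hpow, spectrum.scalar_eq] at h1
    have h2 : t ^ d ∈ (fun s : ℂ => s ^ d) '' spectrum ℂ (shiftMatrix d x 1 1) := ⟨t, ht, rfl⟩
    rw [← h1] at h2
    exact h2
  · rintro ⟨t, rfl, ht⟩
    refine ⟨t, ?_, rfl⟩
    rw [spectrum.mem_iff, Matrix.isUnit_iff_isUnit_det, isUnit_iff_ne_zero, not_not,
      ← Matrix.exists_mulVec_eq_zero_iff]
    refine ⟨fun i => t ^ (d - 1 - i.1), fun h => ?_, ?_⟩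
    · have := congrFun h ⟨d - 1, by omega⟩
      simp at this
    · ext i
      rw [Matrix.sub_mulVec, Pi.sub_apply, shiftMatrix_one_mulVec hd,
        Matrix.algebraMap_eq_diagonal]
      simp only [Matrix.mulVec_diagonal, Pi.zero_apply]
      split_ifs with h
      · rw [← ht]
        simp only [h, Pi.algebraMap_apply, Algebra.algebraMap_self, RingHom.id_apply,
          tsub_zero, tsub_self, pow_zero, mul_one]
        rw [← pow_succ', Nat.sub_add_cancel hd, sub_self]
      · simp only [Pi.algebraMap_apply, Algebra.algebraMap_self, RingHom.id_apply]
        rw [← pow_succ', sub_eq_zero]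
        congr 1
        omega

end CurvePoly

theorem eval_curvePoly_eq_zero_iff {d : ℕ} (hd : 0 < d) {v : Fin 3 → ℝ} (h2 : v 2 = 1) :
    eval v (curvePoly d) = 0 ↔ v ∈ curvePoints d := by
  have h1 : ((eval v (curvePoly d) : ℝ) : ℂ) =
      (Matrix.scalar (Fin d) (v 0 : ℂ) - pencilMatrix d (v 1 : ℂ) 1).det := by
    have := map_det_scalar_sub_pencilMatrix (Complex.ofRealHom.comp (eval v)) d (X 0) (X 1) (X 2)
    simpa [curvePoly, h2] using this
  rw [← Complex.ofReal_eq_zero, h1]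
  have h3 := mem_spectrum_pencilMatrix hd (v 1) (v 0)
  rw [spectrum.mem_iff, Matrix.isUnit_iff_isUnit_det, isUnit_iff_ne_zero, not_not] at h3
  rw [curvePoints, Set.mem_ofPred_eq, ← h3]
  simp only [h2, true_and]
  rfl

theorem isHomogeneous_curvePoly (d : ℕ) : (curvePoly d).IsHomogeneous d := by
  rw [curvePoly, Matrix.det_apply]
  refine IsHomogeneous.sum _ _ _ fun σ _ => ?_
  rw [Units.smul_def, zsmul_eq_mul]
  have hprod : (∏ i, (Matrix.scalar (Fin d) (X 0 : MvPolynomial (Fin 3) ℝ) -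
      pencilMatrix d (X 1) (X 2) : Matrix (Fin d) (Fin d) (MvPolynomial (Fin 3) ℝ))
        (σ i) i).IsHomogeneous (∑ _i : Fin d, 1) := by
    refine IsHomogeneous.prod _ _ _ fun i _ => ?_
    rw [Matrix.sub_apply]
    refine IsHomogeneous.sub ?_ ?_
    · rw [Matrix.scalar_apply, Matrix.diagonal_apply]
      split_ifs
      · exact isHomogeneous_X _ _
      · exact isHomogeneous_zero _ _ _
    · rw [pencilMatrix, Matrix.sum_apply]
      refine IsHomogeneous.sum _ _ _ fun k _ => ?_
      have hc : ((-1) ^ (d - k) * (d.choose k : MvPolynomial (Fin 3) ℝ)) =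
          C ((-1) ^ (d - k) * (d.choose k : ℝ)) := by simp
      rw [Matrix.smul_apply, smul_eq_mul, hc]
      refine IsHomogeneous.C_mul ?_ _
      rw [shiftMatrix, Matrix.of_apply]
      split_ifs
      · exact isHomogeneous_X _ _
      · exact isHomogeneous_X _ _
      · exact isHomogeneous_zero _ _ _
  have hc : (((Equiv.Perm.sign σ : ℤˣ) : ℤ) : MvPolynomial (Fin 3) ℝ) =
      C (((Equiv.Perm.sign σ : ℤˣ) : ℤ) : ℝ) := by simp
  rw [hc]
  simpa only [Finset.sum_const, Finset.card_univ, Fintype.card_fin, smul_eq_mul, mul_one]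
    using hprod.C_mul _

theorem finSuccEquiv_curvePoly (d : ℕ) :
    finSuccEquiv ℝ 2 (curvePoly d) = (pencilMatrix d (X 0) (X 1)).charpoly := by
  have h := map_det_scalar_sub_pencilMatrix
    (finSuccEquiv ℝ 2 : MvPolynomial (Fin 3) ℝ →+* Polynomial (MvPolynomial (Fin 2) ℝ))
    d (X 0) (X 1) (X 2)
  have h1 := finSuccEquiv_X_succ (R := ℝ) (n := 2) (j := 0)
  have h2 := finSuccEquiv_X_succ (R := ℝ) (n := 2) (j := 1)
  simp only [Fin.succ_zero_eq_one] at h1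
  simp only [Fin.succ_one_eq_two] at h2
  simp only [RingHom.coe_coe, finSuccEquiv_X_zero, h1, h2] at h
  rw [curvePoly, h, Matrix.charpoly, Matrix.charmatrix, pencilMatrix_map]

theorem homogeneousComponent_mul_of_isHomogeneous {σ R : Type*} [CommSemiring R] {d : ℕ}
    {P : MvPolynomial σ R} (hP : P.IsHomogeneous d) (m : ℕ) (Q : MvPolynomial σ R) :
    homogeneousComponent (d + m) (P * Q) = P * homogeneousComponent m Q := by
  have h1 (i : ℕ) : homogeneousComponent (d + m) (P * homogeneousComponent i Q) =
      if m = i then P * homogeneousComponent i Q else 0 := by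
    rw [homogeneousComponent_of_mem (hP.mul (homogeneousComponent_isHomogeneous i Q))]
    simp only [Nat.add_left_cancel_iff]
  conv_lhs => rw [← sum_homogeneousComponent Q]
  rw [Finset.mul_sum, map_sum, Finset.sum_congr rfl fun i _ => h1 i, Finset.sum_ite_eq]
  split_ifs with h
  · rfl
  · rw [homogeneousComponent_eq_zero, mul_zero]
    simpa using h

/-- A form vanishing on the curve is a multiple of its equation. -/
theorem exists_eq_curvePoly_mul {d m : ℕ} (hd : 0 < d) {F : MvPolynomial (Fin 3) ℝ}
    (hF : F.IsHomogeneous (d + m)) (h : ∀ v ∈ curvePoints d, eval v F = 0) :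
    ∃ R : MvPolynomial (Fin 3) ℝ, R.IsHomogeneous m ∧ F = curvePoly d * R := by
  have hmonic := Matrix.charpoly_monic (pencilMatrix d (X 0 : MvPolynomial (Fin 2) ℝ) (X 1))
  let Q := (finSuccEquiv ℝ 2).symm (finSuccEquiv ℝ 2 F /ₘ
    (pencilMatrix d (X 0 : MvPolynomial (Fin 2) ℝ) (X 1)).charpoly)
  let S := (finSuccEquiv ℝ 2).symm (finSuccEquiv ℝ 2 F %ₘ
    (pencilMatrix d (X 0 : MvPolynomial (Fin 2) ℝ) (X 1)).charpoly)
  have hdiv : F = S + curvePoly d * Q := by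
    apply (finSuccEquiv ℝ 2).injective
    rw [map_add, map_mul, finSuccEquiv_curvePoly, AlgEquiv.apply_symm_apply,
      AlgEquiv.apply_symm_apply, Polynomial.modByMonic_add_div]
  have hcomp : F = homogeneousComponent (d + m) S +
      curvePoly d * homogeneousComponent m Q := by
    have h1 := congrArg (homogeneousComponent (d + m)) hdiv
    rw [map_add, homogeneousComponent_mul_of_isHomogeneous (isHomogeneous_curvePoly d),
      homogeneousComponent_of_mem hF, if_pos rfl] at h1
    exact h1
  have hS : homogeneousComponent (d + m) S = 0 := by
    refine eq_zero_of_aeval_param_eq_zero (d := d) (homogeneousComponent_isHomogeneous _ _) ?_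
      (aeval_param_eq_zero_of_forall fun v hv => ?_)
    · have hlt : S.degreeOf 0 < d := by
        rw [← natDegree_finSuccEquiv, AlgEquiv.apply_symm_apply]
        have hdeg : (pencilMatrix d (X 0 : MvPolynomial (Fin 2) ℝ) (X 1)).charpoly.natDegree =
            d := by
          simp
        have := Polynomial.natDegree_modByMonic_lt (finSuccEquiv ℝ 2 F) hmonic (by
          intro h1
          rw [h1, Polynomial.natDegree_one] at hdeg
          omega)
        omega
      rw [degreeOf_lt_iff hd] at hlt ⊢
      intro e he
      refine hlt e ?_
      rw [mem_support_iff, coeff_homogeneousComponent] at he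
      rw [mem_support_iff]
      exact fun h0 => he (by simp [h0])
    · have h1 := congrArg (eval v) hcomp
      rw [h v hv, map_add, map_mul, (eval_curvePoly_eq_zero_iff hd hv.1).2 hv, zero_mul,
        add_zero] at h1
      exact h1.symm
  exact ⟨_, homogeneousComponent_isHomogeneous m Q, by rw [hS, zero_add] at hcomp; exact hcomp⟩

/-- Multiplication by a form of degree `d`, as a linear map between spaces of forms. -/
def mulForm {d : ℕ} {P : MvPolynomial (Fin 3) ℝ} (hP : P.IsHomogeneous d) (m : ℕ) :
    homogeneousSubmodule (Fin 3) ℝ m →ₗ[ℝ] homogeneousSubmodule (Fin 3) ℝ (d + m) :=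
  (LinearMap.mulLeft ℝ P).restrict fun _ hR => hP.mul hR

theorem evalForm_mulForm {d m : ℕ} {P : MvPolynomial (Fin 3) ℝ} (hP : P.IsHomogeneous d)
    (v : Fin 3 → ℝ) (R : homogeneousSubmodule (Fin 3) ℝ m) :
    evalForm (d + m) v (mulForm hP m R) = eval v P * evalForm m v R := by
  rw [evalForm_apply, evalForm_apply, ← map_mul]
  rfl

theorem curvePoly_ne_zero (d : ℕ) : curvePoly d ≠ 0 := by
  intro h
  have h1 := finSuccEquiv_curvePoly d
  rw [h, map_zero] at h1
  exact (Matrix.charpoly_monic _).ne_zero h1.symm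

theorem finrank_span_evalForm_curvePoints_le {d : ℕ} (hd : 0 < d) (m : ℕ) :
    Module.finrank ℝ (Submodule.span ℝ (evalForm (d + m) '' curvePoints d)) ≤
      (d + m + 2).choose 2 - (m + 2).choose 2 := by
  have hinj : Function.Injective (mulForm (isHomogeneous_curvePoly d) m) := by
    intro R R' h
    exact Subtype.ext (mul_left_cancel₀ (curvePoly_ne_zero d) (congrArg Subtype.val h))
  have h1 := Subspace.finrank_add_finrank_dualAnnihilator_eq
    (LinearMap.range (mulForm (isHomogeneous_curvePoly d) m))
  rw [LinearMap.finrank_range_of_inj hinj, finrank_homogeneousSubmodule,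
    finrank_homogeneousSubmodule] at h1
  have h2 : Submodule.span ℝ (evalForm (d + m) '' curvePoints d) ≤
      (LinearMap.range (mulForm (isHomogeneous_curvePoly d) m)).dualAnnihilator := by
    rw [Submodule.span_le]
    rintro _ ⟨v, hv, rfl⟩
    rw [SetLike.mem_coe, Submodule.mem_dualAnnihilator]
    rintro _ ⟨R, rfl⟩
    rw [evalForm_mulForm, (eval_curvePoly_eq_zero_iff hd hv.1).2 hv, zero_mul]
  have h3 := Submodule.finrank_mono h2
  omega

/-- Some solitary points of the curve detect forms of degree `m` and impose independent conditions
on forms of degree `m + 3 + m`. -/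
theorem exists_solitaryPoints_basis (m : ℕ) :
    ∃ B ⊆ solitaryPoints (m + 3), LinearIndepOn ℝ (evalForm (m + 3 + m)) B ∧
      ∀ R : MvPolynomial (Fin 3) ℝ, R.IsHomogeneous m → R ≠ 0 → ∃ v ∈ B, eval v R ≠ 0 := by
  obtain ⟨B, hB, -, hspan, hind⟩ := exists_linearIndepOn_extension
    (linearIndepOn_empty ℝ (evalForm m)) (Set.empty_subset (solitaryPoints (m + 3)))
  refine ⟨B, hB, ?_, fun R hR hR0 => ?_⟩
  · have hX : (X 2 ^ (m + 3) : MvPolynomial (Fin 3) ℝ).IsHomogeneous (m + 3) := by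
      simpa using (isHomogeneous_X ℝ (2 : Fin 3)).pow (m + 3)
    refine LinearIndependent.of_comp (mulForm hX m).dualMap ?_
    have heq : ((mulForm hX m).dualMap ∘ fun v : B => evalForm (m + 3 + m) v.1) =
        fun v : B => evalForm m v.1 := by
      ext v R
      have h2 : v.1 2 = 1 := (hB v.2).1
      simp [evalForm_mulForm, h2]
    rw [heq]
    exact hind
  · by_contra! hv
    refine hR0 (eq_zero_of_vanish_solitaryPoints hR fun v hvs => ?_)
    have hle : Submodule.span ℝ (evalForm m '' B) ≤
        LinearMap.ker (Module.Dual.eval ℝ _ (⟨R, hR⟩ : homogeneousSubmodule (Fin 3) ℝ m)) := by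
      rw [Submodule.span_le]
      rintro _ ⟨x, hx, rfl⟩
      simpa [evalForm_apply] using hv x hx
    simpa [evalForm_apply] using hle (hspan ⟨v, hvs, rfl⟩)

theorem exists_points_of_degree_one :
    ∃ p : Fin 3 → RP2, ∀ F : MvPolynomial (Fin 3) ℝ, F ≠ 0 → F.IsHomogeneous 1 →
      ¬ inOneComponent (zeroSet F) (Set.range p) := by
  obtain ⟨p, -, hp⟩ := exists_points_detecting 1 (A := {v | v ≠ 0}) (B := ∅) (fun v hv => hv)
    (Set.empty_subset _) (linearIndepOn_empty _ _) 3 (by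
      refine (Submodule.finrank_le _).trans ?_
      rw [Subspace.dual_finrank_eq, finrank_homogeneousSubmodule]
      decide)
  refine ⟨p, fun F hF0 hF ⟨p₀, _, hS⟩ => hF0 ?_⟩
  have h := hp F hF fun i => connectedComponentIn_subset _ _ (hS ⟨i, rfl⟩)
  refine MvPolynomial.funext fun v => ?_
  rw [map_zero]
  by_cases hv : v = 0
  · have := aeval_smul_of_isHomogeneous hF (0 : ℝ) v
    simpa [aeval_eq_eval, hv] using this
  · exact h v hv

theorem exists_points_of_degree_odd (m : ℕ) :
    ∃ p : Fin ((m + 3 + m + 2).choose 2 - (m + 2).choose 2) → RP2,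
      ∀ F : MvPolynomial (Fin 3) ℝ, F ≠ 0 → F.IsHomogeneous (m + 3 + m) →
        ¬ inOneComponent (zeroSet F) (Set.range p) := by
  have hd : 0 < m + 3 := by omega
  obtain ⟨B, hB, hind, hdetect⟩ := exists_solitaryPoints_basis m
  obtain ⟨p, hpB, hp⟩ := exists_points_detecting (m + 3 + m)
    (fun v (hv : v ∈ curvePoints (m + 3)) => ne_zero_of_apply_two_eq_one hv.1)
    (hB.trans (solitaryPoints_subset _)) hind _ (finrank_span_evalForm_curvePoints_le hd m)
  refine ⟨p, fun F hF0 hF hcomp => ?_⟩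
  have hZ (i) : p i ∈ zeroSet F := by
    obtain ⟨p₀, _, hS⟩ := hcomp
    exact connectedComponentIn_subset _ _ (hS ⟨i, rfl⟩)
  obtain ⟨R, hR, hFR⟩ := exists_eq_curvePoly_mul hd hF (hp F hF hZ)
  obtain ⟨v, hvB, hvR⟩ := hdetect R hR fun h => hF0 (by rw [hFR, h, mul_zero])
  obtain ⟨O, hO, hvO, hOv⟩ := exists_isOpen_inter_curvePoints hd (hB hvB)
  have h2 : v 2 = 1 := (hB hvB).1
  have hopen : IsOpen {w : Fin 3 → ℝ | eval w R ≠ 0} :=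
    isOpen_ne_fun (MvPolynomial.continuous_eval R) continuous_const
  refine not_inOneComponent_of_isolated h2
    (isOpen_chartSet (hO.inter hopen)) ?_ ?_ (hpB v hvB).2 ?_ hcomp
  · rintro x ⟨hxZ, hxV⟩
    induction x using Projectivization.ind with
    | h w hw =>
      rw [mk_mem_chartSet] at hxV
      obtain ⟨hw2, hwO, hwR⟩ := hxV
      rw [mk_eq_mk_affineRep hw hw2] at hxZ ⊢
      rw [eval_rep_mk_eq_zero_iff hF, hFR, map_mul, mul_eq_zero, or_iff_left hwR,
        eval_curvePoly_eq_zero_iff hd (affineRep_apply_two hw2)] at hxZ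
      congr 1
      exact hOv _ hwO hxZ
  · rw [mk_mem_chartSet, affineRep_eq_self h2, h2]
    exact ⟨one_ne_zero, hvO, hvR⟩
  · by_contra! hall
    have hG : (X 2 ^ (m + 2 + m) * (X 1 - C (v 1) * X 2) :
        MvPolynomial (Fin 3) ℝ).IsHomogeneous (m + 3 + m) := by
      have h3 := ((isHomogeneous_X ℝ (2 : Fin 3)).pow (m + 2 + m)).mul
        ((isHomogeneous_X ℝ (1 : Fin 3)).sub ((isHomogeneous_X ℝ (2 : Fin 3)).C_mul (v 1)))
      convert h3 using 1
      omega
    have hvan := hp _ hG fun i => by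
      rw [hall _ ⟨i, rfl⟩, eval_rep_mk_eq_zero_iff hG]
      simp [h2]
    have hval (t : ℝ) : t ^ (m + 3) = v 1 := by
      have := hvan ![(t - 1) ^ (m + 3), t ^ (m + 3), 1] ⟨rfl, t, by simp, by simp⟩
      simpa [sub_eq_zero] using this
    have h0 := hval 0
    have h1 := hval 1
    rw [← h0] at h1
    simp at h1

theorem choose_sub_choose_eq (m : ℕ) :
    (2 * m + 3) * (2 * m + 3 + 3) / 2 - ((2 * m + 3) ^ 2 - 1) / 8 + 1 =
      (m + 3 + m + 2).choose 2 - (m + 2).choose 2 := by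
  obtain ⟨a, ha⟩ := Nat.even_mul_succ_self m
  have e1 : (2 * m + 3) * (2 * m + 3 + 3) = 2 * (4 * a + 7 * m + 9) := by
    linear_combination 4 * ha
  have e2 : (2 * m + 3) ^ 2 = 8 * (a + m + 1) + 1 := by
    linear_combination 4 * ha
  have e3 : (m + 3 + m + 2).choose 2 = 4 * a + 7 * m + 10 := by
    rw [Nat.choose_two_right, show m + 3 + m + 2 - 1 = 2 * m + 4 by omega]
    apply Nat.div_eq_of_eq_mul_left two_pos
    linear_combination 4 * ha
  have e4 : (m + 2).choose 2 = a + m + 1 := by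
    rw [Nat.choose_two_right, show m + 2 - 1 = m + 1 by omega]
    apply Nat.div_eq_of_eq_mul_left two_pos
    linear_combination ha
  rw [e1, e2, e3, e4]
  omega

/-- For odd `q`, `c'(q) ≤ q(q+3)/2 - (q²-1)/8`: with `N = q(q+3)/2 - (q²-1)/8` there exist
`N + 1` points of `ℝP²` such that no connected component of the real point set of a real
curve of degree `q` contains all of them. -/
theorem stmt_11 (q : ℕ) (hq : 1 ≤ q) (hodd : Odd q) :
    ∃ p : Fin (q * (q + 3) / 2 - (q ^ 2 - 1) / 8 + 1) → RP2,
      ∀ F : MvPolynomial (Fin 3) ℝ, F ≠ 0 → F.IsHomogeneous q →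
        ¬ inOneComponent (zeroSet F) (Set.range p) := by
  obtain ⟨k, rfl⟩ := hodd
  obtain _ | m := k
  · exact exists_points_of_degree_one
  · rw [show 2 * (m + 1) + 1 = 2 * m + 3 by ring, choose_sub_choose_eq,
      show 2 * m + 3 = m + 3 + m by ring]
    exact exists_points_of_degree_odd m
end
end
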